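/- arXiv:1807.06927 — 4 statements merged into one kernel-verified Lean document; each statement's English description precedes it below -/
import Mathlib

section
/- Let μ and ν be Borel probability measures on ℝ with finite first moments such that ∫x dμ(x) > ∫x dν(x). Then there exists a Borel probability measure η on ℝ such that μ ∗ η >₁ ν ∗ η, i.e. the CDFs satisfy F_{μ∗η}(t) ≤ F_{ν∗η}(t) for every t ∈ ℝ and μ ∗ η ≠ ν ∗ η. -/
open MeasureTheory ProbabilityTheory

/-- `μ` first-order stochastically dominates `ν`: the CDF of `μ` lies below that of `ν`. -/
def FSD (μ ν : Measure ℝ) : Prop := ∀ t : ℝ, cdf μ t ≤ cdf ν t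

/-- Strict first-order stochastic dominance: `FSD` together with distinctness. -/
def StrictFSD (μ ν : Measure ℝ) : Prop := FSD μ ν ∧ μ ≠ ν

open scoped ENNReal

/-- value of a convolution on a measurable set -/
lemma aux_conv_apply (α π : Measure ℝ) [SFinite π] {A : Set ℝ} (hA : MeasurableSet A) :
    (α.conv π) A = ∫⁻ s, π ((fun y => s + y) ⁻¹' A) ∂α := by
  rw [← lintegral_indicator_one hA, Measure.lintegral_conv (measurable_one.indicator hA)]
  refine lintegral_congr fun s => ?_
  rw [← lintegral_indicator_one (hA.preimage (measurable_const_add s))]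
  rfl

lemma aux_conv_mono {α α' π : Measure ℝ} [SFinite π] (h : α ≤ α') :
    α.conv π ≤ α'.conv π := by
  refine Measure.le_iff.2 fun A hA => ?_
  rw [aux_conv_apply _ _ hA, aux_conv_apply _ _ hA]
  exact lintegral_mono' h le_rfl

/-- two-sided exponential measure -/
noncomputable def auxLap (r : ℝ) : Measure ℝ :=
  volume.withDensity (fun x => ENNReal.ofReal (Real.exp (-(r * |x|))))

instance (r : ℝ) : SFinite (auxLap r) := by unfold auxLap; infer_instance

lemma auxLap_shift {r : ℝ} (hr : 0 ≤ r) (s : ℝ) {A : Set ℝ} (hA : MeasurableSet A) :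
    ENNReal.ofReal (Real.exp (-(r * |s|))) * auxLap r A ≤ auxLap r ((fun y => s + y) ⁻¹' A) := by
  have hm : Measurable (fun x : ℝ => ENNReal.ofReal (Real.exp (-(r * |x|)))) := by fun_prop
  unfold auxLap
  rw [withDensity_apply _ hA, withDensity_apply _ (hA.preimage (measurable_const_add s))]
  have := (measurePreserving_add_left (volume : Measure ℝ) s).setLIntegral_comp_preimage hA
    (f := fun y => ENNReal.ofReal (Real.exp (-(r * |y - s|)))) (by fun_prop)
  simp only [add_sub_cancel_left] at this
  rw [this, ← lintegral_const_mul _ hm]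
  refine lintegral_mono fun y => ?_
  simp only
  rw [← ENNReal.ofReal_mul (Real.exp_pos _).le, ← Real.exp_add]
  refine ENNReal.ofReal_le_ofReal (Real.exp_le_exp.2 ?_)
  have : |y - s| ≤ |y| + |s| := abs_sub y s
  nlinarith

lemma auxLap_shift' {r : ℝ} (hr : 0 ≤ r) (s : ℝ) {A : Set ℝ} (hA : MeasurableSet A) :
    auxLap r ((fun y => s + y) ⁻¹' A) ≤ ENNReal.ofReal (Real.exp (r * |s|)) * auxLap r A := by
  have h := auxLap_shift hr (-s) (hA.preimage (measurable_const_add s))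
  have e : (fun y => -s + y) ⁻¹' ((fun y => s + y) ⁻¹' A) = A := by
    ext y; simp
  rw [e, abs_neg] at h
  calc _ = ENNReal.ofReal (Real.exp (r * |s|)) * (ENNReal.ofReal (Real.exp (-(r * |s|))) *
        auxLap r ((fun y => s + y) ⁻¹' A)) := by
        rw [← mul_assoc, ← ENNReal.ofReal_mul (Real.exp_pos _).le, ← Real.exp_add]
        simp
    _ ≤ _ := by gcongr

lemma auxLap_fin {r : ℝ} (hr : 0 < r) : IsFiniteMeasure (auxLap r) := by
  unfold auxLap
  refine isFiniteMeasure_withDensity_ofReal ?_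
  have : Integrable (fun x : ℝ => Real.exp (-(r * |x|))) := by
    rw [← integrableOn_univ, ← Set.Iic_union_Ioi (a := (0 : ℝ))]
    refine IntegrableOn.union ?_ ?_
    · refine (integrableOn_exp_mul_Iic hr 0).congr_fun (fun x hx => ?_) measurableSet_Iic
      simp only
      rw [abs_of_nonpos hx]
      ring_nf
    · refine (integrableOn_exp_mul_Ioi (neg_lt_zero.2 hr) 0).congr_fun (fun x hx => ?_)
        measurableSet_Ioi
      simp only
      rw [abs_of_pos hx]
      ring_nf
  exact this.2

lemma auxLap_ne {r : ℝ} : auxLap r ≠ 0 := by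
  unfold auxLap
  rw [Ne, withDensity_eq_zero_iff (by fun_prop)]
  intro h
  have : ∀ᵐ x : ℝ, False := by
    filter_upwards [h] with x hx
    simp at hx
    linarith [Real.exp_pos (-(r * |x|))]
  obtain ⟨x, hx⟩ := this.exists
  exact hx

lemma aux_series (θ : Measure ℝ) [IsFiniteMeasure θ] (hθ : θ Set.univ < 1) :
    ∃ h : Measure ℝ, IsFiniteMeasure h ∧ h ≠ 0 ∧ θ.conv h ≤ h := by
  let T : ℕ → Measure ℝ := fun k => (fun τ => θ.conv τ)^[k] (Measure.dirac 0)
  have T0 : T 0 = Measure.dirac 0 := rfl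
  have TS : ∀ k, T (k + 1) = θ.conv (T k) := fun k => Function.iterate_succ_apply' _ _ _
  have hf : ∀ k, IsFiniteMeasure (T k) := by
    intro k
    induction k with
    | zero => rw [T0]; infer_instance
    | succ k ih => rw [TS]; infer_instance
  have hm : ∀ k, T k Set.univ = (θ Set.univ) ^ k := by
    intro k
    induction k with
    | zero => rw [T0]; simp
    | succ k ih => rw [TS, aux_conv_apply _ _ MeasurableSet.univ]; simp [ih, pow_succ]
  refine ⟨Measure.sum T, ⟨?_⟩, ?_, ?_⟩
  · rw [Measure.sum_apply _ MeasurableSet.univ]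
    simp_rw [hm]
    rw [ENNReal.tsum_geometric]
    exact ENNReal.inv_lt_top.2 (tsub_pos_of_lt hθ)
  · intro h0
    have h1 : T 0 ≤ Measure.sum T := Measure.le_sum T 0
    rw [h0, T0] at h1
    have := h1 Set.univ
    simp at this
  · have : θ.conv (Measure.sum T) = Measure.sum (fun k => T (k + 1)) := by
      unfold Measure.conv
      rw [Measure.prod_sum_right, Measure.map_sum (by fun_prop)]
      simp_rw [TS]
      rfl
    rw [this]
    refine Measure.le_iff.2 fun A hA => ?_
    rw [Measure.sum_apply _ hA, Measure.sum_apply _ hA]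
    exact ENNReal.tsum_comp_le_tsum_of_injective (add_left_injective 1) (fun k => T k A)

lemma aux_main (α β : Measure ℝ) [IsFiniteMeasure α] [IsFiniteMeasure β]
    (hab : β Set.univ < α Set.univ) :
    ∃ η : Measure ℝ, IsFiniteMeasure η ∧ η ≠ 0 ∧ β.conv η ≤ α.conv η := by
  -- choose K
  obtain ⟨K, hK0, hK⟩ : ∃ K : ℝ, 0 < K ∧ β Set.univ < α (Set.Icc (-K) K) := by
    have hU : (⋃ n : ℕ, Set.Icc (-((n : ℝ) + 1)) ((n : ℝ) + 1)) = Set.univ := by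
      refine Set.eq_univ_of_forall fun x => ?_
      obtain ⟨n, hn⟩ := exists_nat_ge |x|
      refine Set.mem_iUnion.2 ⟨n, ?_⟩
      have := abs_le.1 hn
      constructor <;> linarith
    have hM : Monotone (fun n : ℕ => Set.Icc (-((n : ℝ) + 1)) ((n : ℝ) + 1)) := by
      intro m n hmn
      have : (m : ℝ) ≤ n := by exact_mod_cast hmn
      exact Set.Icc_subset_Icc (by linarith) (by linarith)
    have ht := tendsto_measure_iUnion_atTop (μ := α) hM
    rw [hU] at ht
    obtain ⟨n, hn⟩ := (ht.eventually (lt_mem_nhds hab)).exists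
    exact ⟨n + 1, by positivity, hn⟩
  set S := Set.Icc (-K) K with hS
  have hSm : MeasurableSet S := measurableSet_Icc
  have hr : ∃ r : ℝ, 0 < r ∧ ENNReal.ofReal (Real.exp (r * K)) * β Set.univ <
      ENNReal.ofReal (Real.exp (-(r * K))) * α S := by
    have h1 : Filter.Tendsto (fun r : ℝ => Real.exp (r * K) * (β Set.univ).toReal)
        (nhdsWithin 0 (Set.Ioi 0)) (nhds (Real.exp (0 * K) * (β Set.univ).toReal)) :=
      (Continuous.tendsto (by fun_prop) 0).mono_left nhdsWithin_le_nhds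
    have h2 : Filter.Tendsto (fun r : ℝ => Real.exp (-(r * K)) * (α S).toReal)
        (nhdsWithin 0 (Set.Ioi 0)) (nhds (Real.exp (-(0 * K)) * (α S).toReal)) :=
      (Continuous.tendsto (by fun_prop) 0).mono_left nhdsWithin_le_nhds
    have h3 := h1.eventually_lt h2 (by
      simpa using (ENNReal.toReal_lt_toReal (measure_ne_top _ _) (measure_ne_top _ _)).2 hK)
    obtain ⟨r, hr, hr0⟩ := (h3.and self_mem_nhdsWithin).exists
    refine ⟨r, hr0, ?_⟩
    rw [← ENNReal.ofReal_toReal (measure_ne_top β Set.univ),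
      ← ENNReal.ofReal_toReal (measure_ne_top α S), ← ENNReal.ofReal_mul (Real.exp_pos _).le,
      ← ENNReal.ofReal_mul (Real.exp_pos _).le]
    exact (ENNReal.ofReal_lt_ofReal_iff_of_nonneg (by positivity)).2 hr
  obtain ⟨r, hr0, hr⟩ := hr
  have := auxLap_fin hr0
  set π := auxLap r with hπ
  set p := ENNReal.ofReal (Real.exp (-(r * K))) * α S with hp
  set q := ENNReal.ofReal (Real.exp (r * K)) * β S with hq
  have hα : p • π ≤ α.conv π := by
    refine Measure.le_iff.2 fun A hA => ?_
    rw [aux_conv_apply _ _ hA]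
    calc (p • π) A = ∫⁻ s in S, ENNReal.ofReal (Real.exp (-(r * K))) * π A ∂α := by
          simp [hp]; ring
      _ ≤ ∫⁻ s in S, π ((fun y => s + y) ⁻¹' A) ∂α := by
          refine setLIntegral_mono' hSm fun s hs => ?_
          refine le_trans ?_ (auxLap_shift hr0.le s hA)
          have : |s| ≤ K := abs_le.2 hs
          gcongr
      _ ≤ _ := setLIntegral_le_lintegral _ _
  have hβ1 : (β.restrict S).conv π ≤ q • π := by
    refine Measure.le_iff.2 fun A hA => ?_
    rw [aux_conv_apply _ _ hA]
    calc _ ≤ ∫⁻ s in S, ENNReal.ofReal (Real.exp (r * K)) * π A ∂β := by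
          refine setLIntegral_mono' hSm fun s hs => ?_
          refine le_trans (auxLap_shift' hr0.le s hA) ?_
          have : |s| ≤ K := abs_le.2 hs
          gcongr
      _ = (q • π) A := by
          simp [hq]; ring
  set β2 := β.restrict Sᶜ with hβ2
  have hsum : β = β.restrict S + β2 := (Measure.restrict_add_restrict_compl hSm).symm
  have hpq : q + β2 Set.univ < p := by
    refine lt_of_le_of_lt ?_ hr
    have : β Set.univ = β S + β2 Set.univ := by
      rw [hβ2, Measure.restrict_apply_univ, measure_add_measure_compl hSm]
    rw [this, mul_add]
    gcongr
    refine le_mul_of_one_le_left zero_le ?_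
    rw [ENNReal.one_le_ofReal]
    exact Real.one_le_exp (by positivity)
  have hptop : p ≠ ∞ := ENNReal.mul_ne_top ENNReal.ofReal_ne_top (measure_ne_top _ _)
  have hqp : q ≤ p := le_trans le_self_add hpq.le
  have hqtop : q ≠ ∞ := ne_top_of_le_ne_top hptop hqp
  set c := p - q with hc
  have hcβ : β2 Set.univ < c := by
    rw [hc]
    exact lt_tsub_iff_left.2 hpq
  have hc0 : c ≠ 0 := (lt_of_le_of_lt zero_le hcβ).ne'
  have hctop : c ≠ ∞ := ne_top_of_le_ne_top hptop tsub_le_self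
  have hcq : q + c = p := add_tsub_cancel_of_le hqp
  have hθf : IsFiniteMeasure (c⁻¹ • β2) := Measure.smul_finite _ (ENNReal.inv_ne_top.2 hc0)
  obtain ⟨h, hhf, hh0, hh⟩ := aux_series (c⁻¹ • β2) (by
    rw [Measure.smul_apply, smul_eq_mul, ← ENNReal.div_eq_inv_mul]
    exact (ENNReal.div_lt_iff (Or.inl hc0) (Or.inl hctop)).2 (by simpa using hcβ))
  have hh2 : β2.conv h ≤ c • h := by
    have h1 : β2.conv h = c • ((c⁻¹ • β2).conv h) := by
      rw [← Measure.conv_smul_left, smul_smul, ENNReal.mul_inv_cancel hc0 hctop, one_smul]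
    rw [h1]
    gcongr
  refine ⟨π.conv h, inferInstance, ?_, ?_⟩
  · intro h0
    have h1 : (π.conv h) Set.univ = 0 := by rw [h0]; simp
    rw [aux_conv_apply _ _ MeasurableSet.univ] at h1
    simp [hh0, auxLap_ne, hπ] at h1
  · have e2 : β2.conv (π.conv h) ≤ c • (π.conv h) := by
      rw [Measure.conv_comm π h, ← Measure.conv_assoc, ← Measure.conv_smul_left]
      exact aux_conv_mono hh2
    have e1 : (β.restrict S).conv (π.conv h) ≤ q • (π.conv h) := by
      rw [← Measure.conv_assoc, ← Measure.conv_smul_left]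
      exact aux_conv_mono hβ1
    have e3 : p • (π.conv h) ≤ α.conv (π.conv h) := by
      rw [← Measure.conv_assoc, ← Measure.conv_smul_left]
      exact aux_conv_mono hα
    calc β.conv (π.conv h) = (β.restrict S).conv (π.conv h) + β2.conv (π.conv h) := by
          conv_lhs => rw [hsum]
          rw [Measure.add_conv]
      _ ≤ q • (π.conv h) + c • (π.conv h) := add_le_add e1 e2
      _ = p • (π.conv h) := by rw [← add_smul, hcq]
      _ ≤ _ := e3

/-- Density whose difference (with arguments swapped) is the difference of the CDFs. -/
noncomputable def auxD (μ ν : Measure ℝ) (t : ℝ) : ℝ≥0∞ :=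
  if 0 ≤ t then μ (Set.Ioi t) else ν (Set.Iic t)

lemma aux_meas_Ioi (μ : Measure ℝ) : Measurable (fun t : ℝ => μ (Set.Ioi t)) :=
  Antitone.measurable fun _ _ h => measure_mono (Set.Ioi_subset_Ioi h)

lemma aux_meas_Iic (μ : Measure ℝ) : Measurable (fun t : ℝ => μ (Set.Iic t)) :=
  Monotone.measurable fun _ _ h => measure_mono (Set.Iic_subset_Iic.2 h)

lemma auxD_meas (μ ν : Measure ℝ) : Measurable (auxD μ ν) :=
  Measurable.ite measurableSet_Ici (aux_meas_Ioi μ) (aux_meas_Iic ν)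

lemma auxD_add (μ ν : Measure ℝ) [IsProbabilityMeasure μ] [IsProbabilityMeasure ν] (t : ℝ) :
    auxD μ ν t + μ (Set.Iic t) = auxD ν μ t + ν (Set.Iic t) := by
  unfold auxD
  split_ifs
  · have h : ∀ ρ : Measure ℝ, IsProbabilityMeasure ρ → ρ (Set.Ioi t) + ρ (Set.Iic t) = 1 := by
      intro ρ hρ
      rw [← Set.compl_Iic, add_comm, measure_add_measure_compl measurableSet_Iic, measure_univ]
    rw [h μ inferInstance, h ν inferInstance]
  · rw [add_comm]

lemma auxD_le (μ ν : Measure ℝ) [IsProbabilityMeasure μ] [IsProbabilityMeasure ν] (t : ℝ) :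
    auxD μ ν t ≤ 1 := by
  unfold auxD
  split_ifs
  · exact prob_le_one
  · exact prob_le_one

lemma auxD_lintegral (μ ν : Measure ℝ) [IsProbabilityMeasure μ] [IsProbabilityMeasure ν] :
    ∫⁻ t, auxD μ ν t = (∫⁻ x, ENNReal.ofReal x ∂μ) + ∫⁻ x, ENNReal.ofReal (-x) ∂ν := by
  have h1 : ∫⁻ x, ENNReal.ofReal x ∂μ = ∫⁻ t in Set.Ici 0, auxD μ ν t := by
    have e := lintegral_eq_lintegral_meas_lt μ (f := fun x : ℝ => max x 0)
      (Filter.Eventually.of_forall fun x => le_max_right _ _) (by fun_prop)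
    have e' : ∀ x : ℝ, ENNReal.ofReal (max x 0) = ENNReal.ofReal x := by
      intro x; simp
    simp_rw [e'] at e
    rw [e, setLIntegral_congr (Ioi_ae_eq_Ici (a := (0 : ℝ)))]
    rw [← setLIntegral_congr (Ioi_ae_eq_Ici (a := (0 : ℝ))),
      ← setLIntegral_congr (Ioi_ae_eq_Ici (a := (0 : ℝ)))]
    refine setLIntegral_congr_fun measurableSet_Ioi fun t ht => ?_
    have ht' : (0 : ℝ) < t := ht
    simp only [auxD, if_pos ht'.le]
    congr 1
    ext a
    simp [ht'.le, not_lt.2 ht'.le]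
  have h2 : ∫⁻ x, ENNReal.ofReal (-x) ∂ν = ∫⁻ t in (Set.Ici 0)ᶜ, auxD μ ν t := by
    have e := lintegral_eq_lintegral_meas_le ν (f := fun x : ℝ => max (-x) 0)
      (Filter.Eventually.of_forall fun x => le_max_right _ _) (by fun_prop)
    have e' : ∀ x : ℝ, ENNReal.ofReal (max (-x) 0) = ENNReal.ofReal (-x) := by
      intro x; simp
    simp_rw [e'] at e
    have hp := (Measure.measurePreserving_neg (volume : Measure ℝ)).setLIntegral_comp_preimage
      (s := (Set.Ici 0)ᶜ) measurableSet_Ici.compl (auxD_meas μ ν)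
    rw [e, ← hp]
    have hs : (Neg.neg ⁻¹' (Set.Ici (0 : ℝ))ᶜ) = Set.Ioi 0 := by
      ext x; simp
    rw [hs]
    refine setLIntegral_congr_fun measurableSet_Ioi fun t ht => ?_
    have ht' : (0 : ℝ) < t := ht
    simp only [auxD]
    rw [if_neg (by linarith)]
    congr 1
    ext a
    simp only [Set.mem_ofPred_eq, Set.mem_Iic, le_max_iff]
    constructor
    · rintro (h | h) <;> linarith
    · intro h; left; linarith
  rw [h1, h2, lintegral_add_compl _ measurableSet_Ici]

lemma aux_conv_density (f : ℝ → ℝ≥0∞) (hf : Measurable f) (η : Measure ℝ) [SFinite η]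
    {A : Set ℝ} (hA : MeasurableSet A) :
    ((volume.withDensity f).conv η) A = ∫⁻ t in A, ∫⁻ s, f (t - s) ∂η := by
  rw [Measure.conv_comm, aux_conv_apply _ _ hA, lintegral_lintegral_swap (by fun_prop)]
  refine lintegral_congr fun s => ?_
  rw [withDensity_apply _ (hA.preimage (measurable_const_add s))]
  have := (measurePreserving_add_left (volume : Measure ℝ) s).setLIntegral_comp_preimage hA
    (f := fun y => f (y - s)) (by fun_prop)
  simpa only [add_sub_cancel_left] using this

lemma aux_conv_Iic (μ η : Measure ℝ) [SFinite μ] [SFinite η] (t : ℝ) :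
    (μ.conv η) (Set.Iic t) = ∫⁻ s, μ (Set.Iic (t - s)) ∂η := by
  rw [Measure.conv_comm, aux_conv_apply _ _ measurableSet_Iic]
  refine lintegral_congr fun s => ?_
  congr 1
  ext y
  simp [le_sub_iff_add_le']

theorem stmt_0 (μ ν : Measure ℝ) [IsProbabilityMeasure μ] [IsProbabilityMeasure ν]
    (hμ : Integrable (fun x : ℝ => x) μ) (hν : Integrable (fun x : ℝ => x) ν)
    (hmean : (∫ x, x ∂ν) < ∫ x, x ∂μ) :
    ∃ η : Measure ℝ, IsProbabilityMeasure η ∧ StrictFSD (μ.conv η) (ν.conv η) := by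
  have hμ1 : ∫⁻ x, ENNReal.ofReal x ∂μ ≠ ∞ := hμ.lintegral_lt_top.ne
  have hμ2 : ∫⁻ x, ENNReal.ofReal (-x) ∂μ ≠ ∞ := hμ.neg.lintegral_lt_top.ne
  have hν1 : ∫⁻ x, ENNReal.ofReal x ∂ν ≠ ∞ := hν.lintegral_lt_top.ne
  have hν2 : ∫⁻ x, ENNReal.ofReal (-x) ∂ν ≠ ∞ := hν.neg.lintegral_lt_top.ne
  have hAtop : ∫⁻ t, auxD μ ν t ≠ ∞ := by
    rw [auxD_lintegral]; exact ENNReal.add_ne_top.2 ⟨hμ1, hν2⟩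
  have hBtop : ∫⁻ t, auxD ν μ t ≠ ∞ := by
    rw [auxD_lintegral]; exact ENNReal.add_ne_top.2 ⟨hν1, hμ2⟩
  have hlt : ∫⁻ t, auxD ν μ t < ∫⁻ t, auxD μ ν t := by
    rw [← ENNReal.toReal_lt_toReal hBtop hAtop, auxD_lintegral, auxD_lintegral,
      ENNReal.toReal_add hν1 hμ2, ENNReal.toReal_add hμ1 hν2]
    rw [integral_eq_lintegral_pos_part_sub_lintegral_neg_part hμ,
      integral_eq_lintegral_pos_part_sub_lintegral_neg_part hν] at hmean
    linarith
  have hfa : IsFiniteMeasure (volume.withDensity (auxD μ ν)) := isFiniteMeasure_withDensity hAtop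
  have hfb : IsFiniteMeasure (volume.withDensity (auxD ν μ)) := isFiniteMeasure_withDensity hBtop
  obtain ⟨η₀, hη₀, hη₀0, hle₀⟩ := aux_main (volume.withDensity (auxD μ ν))
    (volume.withDensity (auxD ν μ)) (by simpa [withDensity_apply] using hlt)
  have hη₀u : η₀ Set.univ ≠ 0 := by simpa using hη₀0
  obtain ⟨η, hη, hle⟩ : ∃ η : Measure ℝ, IsProbabilityMeasure η ∧
      (volume.withDensity (auxD ν μ)).conv η ≤ (volume.withDensity (auxD μ ν)).conv η := by
    have hpr : IsProbabilityMeasure ((η₀ Set.univ)⁻¹ • η₀) :=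
      ⟨by simp [ENNReal.inv_mul_cancel hη₀u (measure_ne_top _ _)]⟩
    refine ⟨(η₀ Set.univ)⁻¹ • η₀, hpr, ?_⟩
    rw [Measure.conv_comm, Measure.conv_comm _ ((η₀ Set.univ)⁻¹ • η₀), Measure.conv_smul_left,
      Measure.conv_smul_left, Measure.conv_comm η₀, Measure.conv_comm η₀]
    gcongr
  refine ⟨η, hη, ?_⟩
  have hadd : ∀ t, (∫⁻ s, auxD μ ν (t - s) ∂η) + (μ.conv η) (Set.Iic t) =
      (∫⁻ s, auxD ν μ (t - s) ∂η) + (ν.conv η) (Set.Iic t) := by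
    intro t
    have m1 : Measurable fun s => auxD μ ν (t - s) :=
      (auxD_meas μ ν).comp (measurable_id.const_sub t)
    have m2 : Measurable fun s => auxD ν μ (t - s) :=
      (auxD_meas ν μ).comp (measurable_id.const_sub t)
    rw [aux_conv_Iic, aux_conv_Iic, ← lintegral_add_left m1, ← lintegral_add_left m2]
    exact lintegral_congr fun s => auxD_add μ ν (t - s)
  have hfin : ∀ t, ∫⁻ s, auxD ν μ (t - s) ∂η ≠ ∞ := by
    intro t
    refine ne_top_of_le_ne_top ENNReal.one_ne_top ?_
    calc _ ≤ ∫⁻ s, 1 ∂η := lintegral_mono fun s => auxD_le ν μ _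
      _ = 1 := by simp
  have hae : ∀ᵐ t : ℝ, ∫⁻ s, auxD ν μ (t - s) ∂η ≤ ∫⁻ s, auxD μ ν (t - s) ∂η := by
    have hm := auxD_meas ν μ
    refine ae_le_of_forall_setLIntegral_le_of_sigmaFinite ?_ fun A hA _ => ?_
    · exact Measurable.lintegral_prod_right' (f := fun z : ℝ × ℝ => auxD ν μ (z.1 - z.2))
        (by fun_prop)
    · rw [← aux_conv_density _ (auxD_meas ν μ) η hA, ← aux_conv_density _ (auxD_meas μ ν) η hA]
      exact hle A
  have hcdf : ∀ᵐ t : ℝ, cdf (μ.conv η) t ≤ cdf (ν.conv η) t := by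
    filter_upwards [hae] with t ht
    rw [cdf_eq_real, cdf_eq_real]
    refine ENNReal.toReal_mono (measure_ne_top _ _) ?_
    have h1 : (∫⁻ s, auxD ν μ (t - s) ∂η) + (μ.conv η) (Set.Iic t) ≤
        (∫⁻ s, auxD ν μ (t - s) ∂η) + (ν.conv η) (Set.Iic t) := by
      rw [← hadd t]; gcongr
    exact (ENNReal.add_le_add_iff_left (hfin t)).1 h1
  refine ⟨fun t => ?_, fun heq => ?_⟩
  · have hc1 := ((cdf (μ.conv η)).right_continuous t).mono Set.Ioi_subset_Ici_self
    have hc2 := ((cdf (ν.conv η)).right_continuous t).mono Set.Ioi_subset_Ici_self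
    have hfr : ∃ᶠ x in nhdsWithin t (Set.Ioi t), cdf (μ.conv η) x ≤ cdf (ν.conv η) x := by
      intro hev
      obtain ⟨u, hu, hsub⟩ := mem_nhdsGT_iff_exists_Ioo_subset.1 hev
      have h0 : volume (Set.Ioo t u) = 0 :=
        measure_mono_null hsub (by simpa [ae_iff] using hcdf)
      rw [Real.volume_Ioo, ENNReal.ofReal_eq_zero] at h0
      have : t < u := hu
      linarith
    by_contra hcon
    push Not at hcon
    have hev := hc2.tendsto.eventually_lt hc1.tendsto hcon
    obtain ⟨x, hx1, hx2⟩ := (hfr.and_eventually hev).exists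
    exact absurd hx1 (not_le.2 hx2)
  · have hE : ∀ t, ∫⁻ s, auxD μ ν (t - s) ∂η = ∫⁻ s, auxD ν μ (t - s) ∂η := by
      intro t
      have := hadd t
      rw [heq] at this
      exact (ENNReal.add_left_inj (measure_ne_top _ _)).1 this
    have hU : ∀ f : ℝ → ℝ≥0∞, Measurable f → ∫⁻ t, ∫⁻ s, f (t - s) ∂η = ∫⁻ t, f t := by
      intro f hf
      rw [← setLIntegral_univ, ← aux_conv_density f hf η MeasurableSet.univ, Measure.conv_comm,
        aux_conv_apply _ _ MeasurableSet.univ]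
      simp
    rw [← hU _ (auxD_meas μ ν), ← hU _ (auxD_meas ν μ)] at hlt
    simp_rw [hE] at hlt
    exact lt_irrefl _ hlt
end

section
/- Let μ and ν be Borel probability measures on ℝ, both with finite absolute moments of all orders, such that ∫x dμ(x) > ∫x dν(x). Then there exists a Borel probability measure η on ℝ with finite absolute moments of all orders such that μ ∗ η >₁ ν ∗ η. -/
open MeasureTheory ProbabilityTheory

/-- All absolute moments of `μ` are finite. -/
def HasAllMoments (μ : Measure ℝ) : Prop := ∀ n : ℕ, Integrable (fun x : ℝ => |x| ^ n) μ

lemma aux_pow (a δ : ℝ) (ha : 0 ≤ a) (hδ : 0 ≤ δ) (hδ1 : δ ≤ 1) (n : ℕ) :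
    (1 + δ * a) ^ n ≤ 1 + δ * ((1 + a) ^ n - 1) := by
  induction n with
  | zero => simp
  | succ n ih =>
    have hP : 0 ≤ (1 + a) ^ n - 1 := by
      have := one_le_pow₀ (n := n) (show (1:ℝ) ≤ 1 + a by linarith)
      linarith
    have h1 : (1 + δ * a) ^ (n+1) ≤ (1 + δ * ((1 + a) ^ n - 1)) * (1 + δ * a) := by
      rw [pow_succ]
      exact mul_le_mul_of_nonneg_right ih (by positivity)
    have h2 : δ * δ * (a * ((1 + a) ^ n - 1)) ≤ δ * (a * ((1 + a) ^ n - 1)) := by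
      apply mul_le_mul_of_nonneg_right _ (by positivity)
      nlinarith
    rw [pow_succ (1 + a)]
    nlinarith

lemma aux_int (ρ : Measure ℝ) (h : HasAllMoments ρ) (n : ℕ) :
    Integrable (fun x : ℝ => |x| * (1 + |x|) ^ n) ρ := by
  have hg : Integrable (fun x : ℝ => 2 ^ (n - 1) * (|x| ^ 1 + |x| ^ (n+1))) ρ :=
    ((h 1).add (h (n+1))).const_mul _
  refine hg.mono' (by fun_prop) (Filter.Eventually.of_forall fun x => ?_)
  rw [Real.norm_of_nonneg (by positivity)]
  have := add_pow_le (zero_le_one (α := ℝ)) (abs_nonneg x) n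
  have h2 := mul_le_mul_of_nonneg_left this (abs_nonneg x)
  calc _ ≤ _ := h2
    _ = _ := by rw [one_pow]; ring

lemma aux_delta (ρ : Measure ℝ) (h : HasAllMoments ρ) (n : ℕ) (ε : ℝ) (hε : 0 < ε) :
    ∃ δ : ℝ, 0 < δ ∧ δ ≤ 1 ∧ n * δ ≤ 1 ∧
      ∫⁻ x, ENNReal.ofReal (|x| * ((1 + δ * |x|) ^ n - 1)) ∂ρ ≤ ENNReal.ofReal ε := by
  set C := ∫ x, |x| * (1 + |x|) ^ n ∂ρ with hC
  have hC0 : 0 ≤ C := integral_nonneg fun x => by positivity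
  refine ⟨min (1 / (n + 1)) (ε / (C + 1)), by positivity, ?_, ?_, ?_⟩
  · refine (min_le_left _ _).trans ?_
    rw [div_le_one (by positivity)]; simp
  · have : (n:ℝ) * min (1 / ((n:ℝ) + 1)) (ε / (C + 1)) ≤ n * (1 / (n+1)) := by
      gcongr; exact min_le_left _ _
    refine this.trans ?_
    rw [mul_one_div, div_le_one (by positivity)]; linarith
  · set δ := min (1 / ((n:ℝ) + 1)) (ε / (C + 1)) with hδ
    have hδ0 : 0 < δ := by positivity
    have hδ1 : δ ≤ 1 := by
      refine (min_le_left _ _).trans ?_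
      rw [div_le_one (by positivity)]; simp
    calc _ ≤ ∫⁻ x, ENNReal.ofReal (δ * (|x| * (1 + |x|) ^ n)) ∂ρ := by
          refine lintegral_mono fun x => ENNReal.ofReal_le_ofReal ?_
          have := aux_pow |x| δ (abs_nonneg x) hδ0.le hδ1 n
          have h3 : (1 + δ * |x|) ^ n - 1 ≤ δ * (1 + |x|) ^ n := by nlinarith
          calc _ ≤ |x| * (δ * (1 + |x|) ^ n) := mul_le_mul_of_nonneg_left h3 (abs_nonneg x)
            _ = _ := by ring
      _ = ENNReal.ofReal (∫ x, δ * (|x| * (1 + |x|) ^ n) ∂ρ) := by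
          rw [ofReal_integral_eq_lintegral_ofReal ((aux_int ρ h n).const_mul δ)]
          exact Filter.Eventually.of_forall fun x => by
            show (0:ℝ) ≤ δ * (|x| * (1 + |x|) ^ n)
            positivity
      _ ≤ ENNReal.ofReal ε := by
          apply ENNReal.ofReal_le_ofReal
          rw [integral_const_mul, ← hC]
          calc δ * C ≤ ε / (C + 1) * (C + 1) := by
                gcongr
                · exact min_le_right _ _
                · linarith
            _ = ε := by field_simp

/-- The weight. -/
noncomputable def wt (δ : ℕ → ℝ) (x : ℝ) : ℝ := ⨆ n : ℕ, (1 + δ n * |x|) ^ n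

section
variable {δ : ℕ → ℝ}

lemma wt_bdd (h0 : ∀ n, 0 < δ n) (h1 : ∀ n, n * δ n ≤ 1) (x : ℝ) :
    BddAbove (Set.range fun n : ℕ => (1 + δ n * |x|) ^ n) := by
  refine ⟨Real.exp |x|, ?_⟩
  rintro _ ⟨n, rfl⟩
  have := h0 n
  calc (1 + δ n * |x|) ^ n ≤ (Real.exp (δ n * |x|)) ^ n := by
        gcongr; rw [add_comm]; exact Real.add_one_le_exp _
    _ = Real.exp ((n * δ n) * |x|) := by rw [← Real.exp_nat_mul]; ring_nf
    _ ≤ Real.exp |x| := by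
        apply Real.exp_le_exp.2
        have := mul_le_mul_of_nonneg_right (h1 n) (abs_nonneg x)
        linarith

lemma le_wt (h0 : ∀ n, 0 < δ n) (h1 : ∀ n, n * δ n ≤ 1)
    (n : ℕ) (x : ℝ) : (1 + δ n * |x|) ^ n ≤ wt δ x :=
  le_ciSup (wt_bdd h0 h1 x) n

lemma one_le_wt (h0 : ∀ n, 0 < δ n) (h1 : ∀ n, n * δ n ≤ 1)
    (x : ℝ) : 1 ≤ wt δ x := by
  simpa using le_wt h0 h1 0 x

lemma wt_mono (h0 : ∀ n, 0 < δ n) (h1 : ∀ n, n * δ n ≤ 1)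
    {x y : ℝ} (h : |x| ≤ |y|) : wt δ x ≤ wt δ y := by
  refine ciSup_le fun n => le_trans ?_ (le_wt h0 h1 n y)
  have := h0 n
  gcongr

lemma wt_sub (h0 : ∀ n, 0 < δ n) (h1 : ∀ n, n * δ n ≤ 1)
    (x y : ℝ) : wt δ (x + y) ≤ wt δ x * wt δ y := by
  refine ciSup_le fun n => ?_
  have := h0 n
  calc (1 + δ n * |x + y|) ^ n ≤ ((1 + δ n * |x|) * (1 + δ n * |y|)) ^ n := by
        gcongr
        have := mul_le_mul_of_nonneg_left (abs_add_le x y) this.le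
        have : 0 ≤ δ n * |x| * (δ n * |y|) := by positivity
        nlinarith
    _ = (1 + δ n * |x|) ^ n * (1 + δ n * |y|) ^ n := mul_pow _ _ _
    _ ≤ _ := by
        gcongr
        · linarith [one_le_wt h0 h1 x]
        · exact le_wt h0 h1 n x
        · exact le_wt h0 h1 n y

lemma wt_meas : Measurable (wt δ) := by
  unfold wt
  exact Measurable.iSup fun n => by fun_prop

lemma wt_inv_close (h0 : ∀ n, 0 < δ n) (h1 : ∀ n, n * δ n ≤ 1)
    (t u : ℝ) :
    |(wt δ u)⁻¹ - (wt δ t)⁻¹| ≤ (wt δ t)⁻¹ * (wt δ (u - t) - 1) := by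
  have a := one_le_wt h0 h1 u
  have b := one_le_wt h0 h1 t
  have c := one_le_wt h0 h1 (u - t)
  have e1 : wt δ u ≤ wt δ t * wt δ (u - t) := by
    simpa using wt_sub h0 h1 t (u - t)
  have e2 : wt δ t ≤ wt δ u * wt δ (u - t) := by
    have := wt_sub h0 h1 u (t - u)
    rw [add_sub_cancel] at this
    exact this.trans (mul_le_mul_of_nonneg_left
      (wt_mono h0 h1 (abs_sub_comm t u).le) (by linarith))
  generalize wt δ u = U at *
  generalize wt δ t = T at *
  generalize wt δ (u - t) = W at *
  have hU : 0 < U := by linarith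
  have hT : 0 < T := by linarith
  have : U⁻¹ - T⁻¹ = T⁻¹ * (T / U - 1) := by field_simp
  rw [this, abs_mul, abs_of_pos (inv_pos.2 hT)]
  apply mul_le_mul_of_nonneg_left _ (inv_pos.2 hT).le
  rw [abs_le]
  constructor
  · have : W⁻¹ ≤ T / U := by
      rw [inv_eq_one_div, div_le_div_iff₀ (by linarith) hU]; linarith
    have h2 : 2 - W ≤ W⁻¹ := by
      rw [inv_eq_one_div, le_div_iff₀ (by linarith)]
      nlinarith [sq_nonneg (W - 1)]
    linarith
  · have : T / U ≤ W := by rw [div_le_iff₀ hU]; linarith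
    linarith

lemma wt_inv_mom (h0 : ∀ n, 0 < δ n) (h1 : ∀ n, n * δ n ≤ 1)
    (n : ℕ) : Integrable (fun x : ℝ => |x| ^ n * (wt δ x)⁻¹) volume := by
  have hr : Integrable (fun x : ℝ => (1 + ‖x‖) ^ (-(2:ℝ))) volume :=
    integrable_one_add_norm (by simp)
  set d := min (δ (n+2)) 1 with hd
  have hd0 : 0 < d := lt_min (h0 _) one_pos
  refine (hr.const_mul ((d ^ (n+2))⁻¹)).mono' ?_ (Filter.Eventually.of_forall fun x => ?_)
  · exact (Measurable.mul (by fun_prop) wt_meas.inv).aestronglyMeasurable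
  · have hw := one_le_wt h0 h1 x
    rw [Real.norm_of_nonneg (by positivity), Real.norm_eq_abs, Real.rpow_neg (by positivity)]
    have e : (d * (1 + |x|)) ^ (n+2) ≤ wt δ x := by
      refine le_trans ?_ (le_wt h0 h1 (n+2) x)
      have a1 : d ≤ 1 := min_le_right _ _
      have a2 : d * |x| ≤ δ (n+2) * |x| :=
        mul_le_mul_of_nonneg_right (min_le_left _ _) (abs_nonneg x)
      gcongr
      linarith
    have e2 : (1 + |x|) ^ (2:ℝ) = (1 + |x|) ^ 2 := by norm_cast
    rw [e2, ← mul_inv, ← div_eq_mul_inv, ← one_div, div_le_div_iff₀ (by positivity) (by positivity),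
      one_mul]
    refine le_trans ?_ e
    have : |x| ^ n ≤ (1 + |x|) ^ n := by gcongr; linarith
    calc |x| ^ n * (d ^ (n+2) * (1 + |x|) ^ 2) ≤ (1 + |x|) ^ n * (d ^ (n+2) * (1 + |x|) ^ 2) := by
          gcongr
      _ = _ := by rw [mul_pow]; ring

lemma wt_lint (ρ : Measure ℝ) (ε : ℝ) (hε : 0 < ε)
    (h : ∀ n : ℕ, ∫⁻ x, ENNReal.ofReal (|x| * ((1 + δ n * |x|) ^ n - 1)) ∂ρ
      ≤ ENNReal.ofReal (ε / 2 / 2 ^ n)) :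
    ∫⁻ x, ENNReal.ofReal (|x| * (wt δ x - 1)) ∂ρ ≤ ENNReal.ofReal ε := by
  calc _ ≤ ∫⁻ x, ∑' n : ℕ, ENNReal.ofReal (|x| * ((1 + δ n * |x|) ^ n - 1)) ∂ρ := by
        refine lintegral_mono fun x => ?_
        set T := ∑' n : ℕ, ENNReal.ofReal (|x| * ((1 + δ n * |x|) ^ n - 1)) with hT
        by_cases hTt : T = ⊤
        · simp [hTt]
        have hn : ∀ n : ℕ, |x| * ((1 + δ n * |x|) ^ n - 1) ≤ T.toReal := fun n => by
          rw [← ENNReal.ofReal_le_iff_le_toReal hTt]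
          exact ENNReal.le_tsum (f := fun n : ℕ => ENNReal.ofReal (|x| * ((1 + δ n * |x|) ^ n - 1))) n
        show ENNReal.ofReal (|x| * (wt δ x - 1)) ≤ T
        rw [ENNReal.ofReal_le_iff_le_toReal hTt]
        rcases (abs_nonneg x).eq_or_lt with hx | hx
        · rw [← hx]; simp
        · have : wt δ x ≤ 1 + T.toReal / |x| := ciSup_le fun n => by
            have := (le_div_iff₀' hx).2 (hn n)
            linarith
          rw [← le_div_iff₀' hx]; linarith
    _ = ∑' n : ℕ, ∫⁻ x, ENNReal.ofReal (|x| * ((1 + δ n * |x|) ^ n - 1)) ∂ρ :=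
        lintegral_tsum fun n => by fun_prop
    _ ≤ ∑' n : ℕ, ENNReal.ofReal (ε / 2 / 2 ^ n) := ENNReal.tsum_le_tsum h
    _ = ENNReal.ofReal ε := by
        rw [← ENNReal.ofReal_tsum_of_nonneg (fun n => by positivity) (summable_geometric_two' ε),
          tsum_geometric_two']

end

lemma cdf_conv (μ η : Measure ℝ) [IsProbabilityMeasure μ] [IsProbabilityMeasure η] (t : ℝ) :
    Integrable (fun x => cdf η (t - x)) μ ∧ cdf (μ.conv η) t = ∫ x, cdf η (t - x) ∂μ := by
  have hm : Measurable (fun x => cdf η (t - x)) :=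
    (monotone_cdf η).measurable.comp (by fun_prop)
  have hi : Integrable (fun x => cdf η (t - x)) μ := by
    refine (integrable_const (1:ℝ)).mono' hm.aestronglyMeasurable
      (Filter.Eventually.of_forall fun x => ?_)
    rw [Real.norm_of_nonneg (cdf_nonneg _ _)]
    exact cdf_le_one _ _
  refine ⟨hi, ?_⟩
  rw [cdf_eq_real, measureReal_def, ← lintegral_indicator_one measurableSet_Iic,
    Measure.lintegral_conv (by exact measurable_one.indicator measurableSet_Iic),
    integral_eq_lintegral_of_nonneg_ae (Filter.Eventually.of_forall fun x => cdf_nonneg _ _)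
      hm.aestronglyMeasurable]
  congr 1
  refine lintegral_congr fun x => ?_
  rw [cdf_eq_real, ofReal_measureReal, ← lintegral_indicator_one measurableSet_Iic]
  refine lintegral_congr fun y => ?_
  simp only [Set.indicator, Set.mem_Iic, le_sub_iff_add_le', Pi.one_apply]

theorem stmt_1 (μ ν : Measure ℝ) [IsProbabilityMeasure μ] [IsProbabilityMeasure ν]
    (hμ : HasAllMoments μ) (hν : HasAllMoments ν)
    (hmean : (∫ x, x ∂ν) < ∫ x, x ∂μ) :
    ∃ η : Measure ℝ, IsProbabilityMeasure η ∧ HasAllMoments η ∧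
      StrictFSD (μ.conv η) (ν.conv η) := by
  set d := (∫ x, x ∂μ) - ∫ x, x ∂ν with hd
  have hd0 : 0 < d := by linarith
  have hρ : HasAllMoments (μ + ν) := fun n => (hμ n).add_measure (hν n)
  choose δ h0 _ h1 h2 using fun n : ℕ =>
    aux_delta (μ + ν) hρ n (d / 2 / 2 / 2 ^ n) (by positivity)
  have hL := wt_lint (μ + ν) (d / 2) (by positivity) h2
  have hw1 := one_le_wt h0 h1
  have hwp : ∀ x, 0 < (wt δ x)⁻¹ := fun x => inv_pos.2 (by linarith [hw1 x])
  -- integrability of the error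
  have hEm : Measurable (fun x : ℝ => |x| * (wt δ x - 1)) :=
    Measurable.mul (by fun_prop) (wt_meas.sub_const 1)
  have hEn : ∀ x : ℝ, 0 ≤ |x| * (wt δ x - 1) := fun x =>
    mul_nonneg (abs_nonneg x) (by linarith [hw1 x])
  have hE : Integrable (fun x : ℝ => |x| * (wt δ x - 1)) (μ + ν) := by
    refine ⟨hEm.aestronglyMeasurable, ?_⟩
    rw [hasFiniteIntegral_iff_ofReal (Filter.Eventually.of_forall hEn)]
    exact hL.trans_lt ENNReal.ofReal_lt_top
  have hEle : ∫ x, |x| * (wt δ x - 1) ∂(μ + ν) ≤ d / 2 := by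
    rw [integral_eq_lintegral_of_nonneg_ae (Filter.Eventually.of_forall hEn)
      hEm.aestronglyMeasurable]
    exact ENNReal.toReal_le_of_le_ofReal (by positivity) hL
  have hEμ := hE.left_of_add_measure
  have hEν := hE.right_of_add_measure
  rw [integral_add_measure hEμ hEν] at hEle
  -- density
  have hint : Integrable (fun x => (wt δ x)⁻¹) volume := by
    simpa using wt_inv_mom h0 h1 0
  set Z := ∫ x, (wt δ x)⁻¹ with hZ
  have hZ0 : 0 < Z := by
    rw [hZ, integral_pos_iff_support_of_nonneg (fun x => (hwp x).le) hint]
    have : Function.support (fun x => (wt δ x)⁻¹) = Set.univ := by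
      ext x; simpa using (inv_pos.1 (hwp x)).ne'
    rw [this]; simp
  set f : ℝ → ℝ := fun x => Z⁻¹ * (wt δ x)⁻¹ with hf
  have hfm : Measurable f := measurable_const.mul wt_meas.inv
  have hf0 : ∀ x, 0 ≤ f x := fun x => mul_nonneg (inv_pos.2 hZ0).le (hwp x).le
  have hfi : Integrable f volume := hint.const_mul _
  set η : Measure ℝ := volume.withDensity (fun x => ENNReal.ofReal (f x)) with hη
  have hηp : IsProbabilityMeasure η := by
    constructor
    rw [hη, withDensity_apply _ MeasurableSet.univ, Measure.restrict_univ,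
      ← ofReal_integral_eq_lintegral_ofReal hfi (Filter.Eventually.of_forall hf0),
      integral_const_mul, ← hZ, inv_mul_cancel₀ hZ0.ne', ENNReal.ofReal_one]
  have hcdf : ∀ t, cdf η t = ∫ x in Set.Iic t, f x := fun t => by
    rw [cdf_eq_real, measureReal_def, hη, withDensity_apply _ measurableSet_Iic,
      integral_eq_lintegral_of_nonneg_ae (Filter.Eventually.of_forall hf0)
      hfm.aestronglyMeasurable]
  have hclose : ∀ t x, |cdf η t - cdf η (t - x) - x * f t| ≤ f t * (|x| * (wt δ x - 1)) := by
    intro t x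
    rw [hcdf, hcdf, intervalIntegral.integral_Iic_sub_Iic hfi.integrableOn hfi.integrableOn]
    have e : (∫ u in (t - x)..t, f u) - x * f t = ∫ u in (t - x)..t, (f u - f t) := by
      rw [intervalIntegral.integral_sub hfi.intervalIntegrable (by simp)]
      simp
    rw [e, ← Real.norm_eq_abs]
    have := intervalIntegral.norm_integral_le_of_norm_le_const (a := t - x) (b := t)
      (f := fun u => f u - f t) (C := f t * (wt δ x - 1)) (fun u hu => by
        have hux : |u - t| ≤ |x| := by
          rw [Set.mem_uIoc] at hu
          rcases hu with hu | hu
          · rw [abs_le]; constructor <;> cases abs_cases x <;> linarith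
          · rw [abs_le]; constructor <;> cases abs_cases x <;> linarith
        have a := wt_inv_close h0 h1 t u
        have b := wt_mono h0 h1 hux
        have hz := inv_pos.2 hZ0
        simp only [hf, Real.norm_eq_abs]
        rw [← mul_sub, abs_mul, abs_of_pos hz, mul_assoc]
        apply mul_le_mul_of_nonneg_left _ hz.le
        exact a.trans (mul_le_mul_of_nonneg_left (by linarith) (hwp t).le))
    refine this.trans (le_of_eq ?_)
    rw [sub_sub_cancel]; ring
  have hid : ∀ ρ : Measure ℝ, HasAllMoments ρ → Integrable (fun x : ℝ => x) ρ := fun ρ h => by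
    refine (h 1).mono' (by fun_prop) (Filter.Eventually.of_forall fun x => ?_)
    simp
  have hiμ := hid μ hμ
  have hiν := hid ν hν
  have hlt : ∀ t, cdf (μ.conv η) t < cdf (ν.conv η) t := by
    intro t
    obtain ⟨iμ, cμ⟩ := cdf_conv μ η t
    obtain ⟨iν, cν⟩ := cdf_conv ν η t
    have hft : 0 < f t := mul_pos (inv_pos.2 hZ0) (hwp t)
    have u1 : ∫ x, cdf η (t - x) ∂μ ≤
        ∫ x, (cdf η t - x * f t + f t * (|x| * (wt δ x - 1))) ∂μ := by
      refine integral_mono iμ (((integrable_const _).sub (hiμ.mul_const _)).add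
        (hEμ.const_mul _)) fun x => ?_
      have := (abs_le.1 (hclose t x)).1
      show cdf η (t - x) ≤ cdf η t - x * f t + f t * (|x| * (wt δ x - 1))
      linarith
    have u2 : ∫ x, (cdf η t - x * f t - f t * (|x| * (wt δ x - 1))) ∂ν ≤
        ∫ x, cdf η (t - x) ∂ν := by
      refine integral_mono (((integrable_const _).sub (hiν.mul_const _)).sub
        (hEν.const_mul _)) iν fun x => ?_
      have := (abs_le.1 (hclose t x)).2
      show cdf η t - x * f t - f t * (|x| * (wt δ x - 1)) ≤ cdf η (t - x)
      linarith
    have hkμ : Integrable (fun x => cdf η t - x * f t) μ :=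
      (integrable_const _).sub (hiμ.mul_const _)
    have hkν : Integrable (fun x => cdf η t - x * f t) ν :=
      (integrable_const _).sub (hiν.mul_const _)
    rw [integral_add hkμ (hEμ.const_mul _),
      integral_sub (integrable_const _) (hiμ.mul_const _), integral_mul_const,
      integral_const_mul] at u1
    rw [integral_sub hkν (hEν.const_mul _),
      integral_sub (integrable_const _) (hiν.mul_const _), integral_mul_const,
      integral_const_mul] at u2
    simp only [integral_const, probReal_univ, one_smul] at u1 u2
    rw [cμ, cν]
    have key : 0 < f t * (d - (∫ x, |x| * (wt δ x - 1) ∂μ + ∫ x, |x| * (wt δ x - 1) ∂ν)) :=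
      mul_pos hft (by linarith)
    rw [hd] at key
    nlinarith
  refine ⟨η, hηp, ?_, fun t => (hlt t).le, fun h => ?_⟩
  · intro n
    rw [hη, integrable_withDensity_iff (by fun_prop) (by simp)]
    have := (wt_inv_mom h0 h1 n).const_mul Z⁻¹
    refine this.congr (Filter.Eventually.of_forall fun x => ?_)
    show Z⁻¹ * (|x| ^ n * (wt δ x)⁻¹) = |x| ^ n * (ENNReal.ofReal (f x)).toReal
    rw [ENNReal.toReal_ofReal (hf0 x)]
    simp only [hf]
    ring
  · have := hlt 0
    rw [h] at this
    exact lt_irrefl _ this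
end

section
/- Let μ₁, …, μ_k be Borel probability measures on ℝ, each with finite absolute moments of all orders, such that ∫x dμ_i(x) > ∫x dμ_j(x) whenever i > j. Then there exists a Borel probability measure ζ on ℝ with finite absolute moments of all orders such that μ_i ∗ ζ >₁ μ_j ∗ ζ for all i > j. -/
open MeasureTheory ProbabilityTheory

/-- A positive submultiplicative sequence taming a given sequence. -/
lemma exists_weights (M : ℕ → ℝ) (hM : ∀ n, 0 ≤ M n) :
    ∃ b : ℕ → ℝ, (∀ n, 0 < b n) ∧ (∀ n, b n ≤ 1) ∧ b 0 = 1 ∧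
      (∀ m n, b (m + n) ≤ b m * b n) ∧ ∀ n, b (n + 1) * M (n + 2) ≤ 1 := by
  set r : ℕ → ℝ := fun i => (1 + ∑ j ∈ Finset.range (i + 3), M j)⁻¹ with hr
  have hS : ∀ i, 0 ≤ ∑ j ∈ Finset.range i, M j := fun i => Finset.sum_nonneg fun j _ => hM j
  have hrpos : ∀ i, 0 < r i := fun i => by
    have := hS (i + 3)
    simp only [hr]; positivity
  have hr1 : ∀ i, r i ≤ 1 := fun i => by
    have := hS (i + 3)
    exact inv_le_one_of_one_le₀ (by linarith)
  have hanti : Antitone r := by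
    intro i j hij
    have h0 := hS (i + 3)
    apply inv_anti₀ (by positivity)
    refine add_le_add le_rfl (Finset.sum_le_sum_of_subset_of_nonneg
      (Finset.range_mono (by omega)) (fun j _ _ => hM j))
  have hb1 : ∀ n, ∏ i ∈ Finset.range n, r i ≤ 1 := fun n =>
    Finset.prod_le_one (fun i _ => (hrpos i).le) (fun i _ => hr1 i)
  have hbpos : ∀ n, 0 < ∏ i ∈ Finset.range n, r i := fun n =>
    Finset.prod_pos fun i _ => hrpos i
  refine ⟨fun n => ∏ i ∈ Finset.range n, r i, hbpos, hb1, by simp, ?_, ?_⟩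
  · intro m n
    simp only [Finset.prod_range_add]
    apply mul_le_mul_of_nonneg_left _ (hbpos m).le
    exact Finset.prod_le_prod (fun i _ => (hrpos _).le) (fun i _ => hanti (by omega))
  · intro n
    simp only [Finset.prod_range_succ]
    have h1 : r n * M (n + 2) ≤ 1 := by
      have h0 := hS (n + 3)
      have h2 : M (n + 2) ≤ ∑ j ∈ Finset.range (n + 3), M j :=
        Finset.single_le_sum (fun j _ => hM j) (by simp)
      simp only [hr]
      rw [inv_mul_le_iff₀ (by positivity)]
      linarith
    have h3 := hb1 n
    have h4 := hbpos n
    have h5 : 0 ≤ r n * M (n + 2) := mul_nonneg (hrpos n).le (hM _)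
    rw [mul_assoc]
    exact mul_le_one₀ h3 h5 h1

/-- The submultiplicative weight function. -/
lemma exists_H (M : ℕ → ℝ) (hM : ∀ n, 0 ≤ M n) :
    ∃ H : ℝ → ℝ, (∀ x, 0 ≤ x → 1 ≤ H x) ∧ (∀ x y, 0 ≤ x → x ≤ y → H x ≤ H y) ∧
      (∀ x y, 0 ≤ x → 0 ≤ y → H (x + y) ≤ H x * H y) ∧
      (∀ e x, 0 ≤ e → e ≤ 1 → 0 ≤ x → H (e * x) - 1 ≤ e * (H x - 1)) ∧
      (∀ n : ℕ, ∃ c > 0, ∀ x, 0 ≤ x → c * x ^ n ≤ H x) ∧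
      (∀ μ : Measure ℝ, HasAllMoments μ → (∀ n, ∫ x, |x| ^ n ∂μ ≤ M n) →
        Integrable (fun x => |x| * (H |x| - 1)) μ) := by
  obtain ⟨b, hb0, hb1, hbz, hbm, hbM⟩ := exists_weights M hM
  set a : ℕ → ℝ → ℝ := fun n x => b n * (x ^ n / n.factorial) with ha
  have hann : ∀ n x, 0 ≤ x → 0 ≤ a n x := fun n x hx =>
    mul_nonneg (hb0 n).le (by positivity)
  have hsum : ∀ x, 0 ≤ x → Summable (fun n => a n x) := fun x hx =>
    Summable.of_nonneg_of_le (fun n => hann n x hx)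
      (fun n => mul_le_of_le_one_left (by positivity) (hb1 n)) (Real.summable_pow_div_factorial x)
  have hsum1 : ∀ x, 0 ≤ x → Summable (fun n => a (n + 1) x) := fun x hx =>
    (summable_nat_add_iff 1).2 (hsum x hx)
  have hH1 : ∀ x, 0 ≤ x → (∑' n, a n x) - 1 = ∑' n, a (n + 1) x := by
    intro x hx
    rw [(hsum x hx).tsum_eq_zero_add]
    simp [ha, hbz]
  refine ⟨fun x => ∑' n, a n x, ?_, ?_, ?_, ?_, ?_, ?_⟩
  · intro x hx
    have := hH1 x hx
    have h2 : 0 ≤ ∑' n, a (n + 1) x := tsum_nonneg fun n => hann _ x hx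
    simp only; linarith
  · intro x y hx hxy
    refine Summable.tsum_le_tsum (fun n => ?_) (hsum x hx) (hsum y (hx.trans hxy))
    have := (hb0 n).le
    simp only [ha]; gcongr
  · intro x y hx hy
    have nx : Summable fun n => ‖a n x‖ := (hsum x hx).norm
    have ny : Summable fun n => ‖a n y‖ := (hsum y hy).norm
    have hp := summable_norm_sum_mul_antidiagonal_of_summable_norm nx ny
    simp only
    rw [tsum_mul_tsum_eq_tsum_sum_antidiagonal_of_summable_norm nx ny]
    refine Summable.tsum_le_tsum (fun n => ?_) (hsum _ (add_nonneg hx hy)) hp.of_norm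
    simp only [ha]
    rw [add_pow, Finset.sum_div, Finset.mul_sum, ← Finset.Nat.sum_antidiagonal_eq_sum_range_succ
      (fun i j => b n * (x ^ i * y ^ j * (n.choose i : ℝ) / n.factorial))]
    refine Finset.sum_le_sum fun p hp => ?_
    obtain ⟨i, j⟩ := p
    have hp : i + j = n := Finset.HasAntidiagonal.mem_antidiagonal.1 hp
    subst hp
    have hc : ((i + j).choose i : ℝ) / ((i + j).factorial : ℝ)
        = 1 / ((i.factorial : ℝ) * j.factorial) := by
      have : ((i + j).choose i : ℝ) * i.factorial * j.factorial = (i + j).factorial := by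
        rw [Nat.choose_symm_add]
        exact_mod_cast Nat.add_choose_mul_factorial_mul_factorial i j
      rw [div_eq_div_iff (by positivity) (by positivity)]
      linarith
    calc b (i + j) * (x ^ i * y ^ j * ((i + j).choose i : ℝ) / (i + j).factorial)
        = b (i + j) * (x ^ i * y ^ j * (1 / ((i.factorial : ℝ) * j.factorial))) := by
          rw [← hc]; ring
      _ ≤ (b i * b j) * (x ^ i * y ^ j * (1 / ((i.factorial : ℝ) * j.factorial))) :=
          mul_le_mul_of_nonneg_right (hbm i j) (by positivity)
      _ = _ := by field_simp
  · intro e x he he1 hx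
    simp only
    rw [hH1 _ (mul_nonneg he hx), hH1 x hx, ← tsum_mul_left]
    refine Summable.tsum_le_tsum (fun n => ?_) (hsum1 _ (mul_nonneg he hx))
      ((hsum1 x hx).mul_left e)
    have h1 : e ^ (n + 1) ≤ e := by
      rw [pow_succ]; exact mul_le_of_le_one_left he (pow_le_one₀ he he1)
    have h2 := hann (n + 1) x hx
    calc a (n + 1) (e * x) = e ^ (n + 1) * a (n + 1) x := by simp only [ha, mul_pow]; ring
      _ ≤ _ := mul_le_mul_of_nonneg_right h1 h2
  · intro n
    refine ⟨b n / n.factorial, div_pos (hb0 n) (by positivity), fun x hx => ?_⟩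
    have := (hsum x hx).le_tsum n (fun j _ => hann j x hx)
    calc _ = a n x := by simp only [ha]; ring
      _ ≤ _ := this
  · intro μ hμ hμM
    set F : ℕ → ℝ → ℝ := fun n x => |x| * a (n + 1) |x| with hF
    have hFe : ∀ n x, F n x = (b (n + 1) / (n + 1).factorial) * |x| ^ (n + 2) := by
      intro n x; simp only [hF, ha]; ring
    have hFnn : ∀ n x, 0 ≤ F n x := fun n x =>
      mul_nonneg (abs_nonneg x) (hann _ _ (abs_nonneg x))
    have hFi : ∀ n, Integrable (F n) μ := by
      intro n
      have : F n = fun x => (b (n + 1) / (n + 1).factorial) * |x| ^ (n + 2) := funext (hFe n)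
      rw [this]
      exact (hμ (n + 2)).const_mul _
    have heq : (fun x => |x| * ((∑' n, a n |x|) - 1)) = fun x => ∑' n, F n x := by
      funext x
      rw [hH1 _ (abs_nonneg x), ← tsum_mul_left]
    have hFs : ∀ x, Summable fun n => F n x := fun x => (hsum1 _ (abs_nonneg x)).mul_left _
    simp only
    rw [heq]
    have hIs : Summable fun n => ∫ x, ‖F n x‖ ∂μ := by
      refine Summable.of_nonneg_of_le (fun n => integral_nonneg fun x => norm_nonneg _)
        (fun n => ?_) ((summable_nat_add_iff 1).2 (Real.summable_pow_div_factorial 1))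
      have : (fun x => ‖F n x‖) = fun x => (b (n + 1) / (n + 1).factorial) * |x| ^ (n + 2) := by
        funext x; rw [Real.norm_of_nonneg (hFnn n x), hFe]
      rw [this, integral_const_mul]
      have h1 := hbM n
      have h2 := hμM (n + 2)
      have h3 := (hb0 (n + 1)).le
      calc _ = (b (n + 1) * ∫ x, |x| ^ (n + 2) ∂μ) / (n + 1).factorial := by ring
        _ ≤ (b (n + 1) * M (n + 2)) / (n + 1).factorial := by gcongr
        _ ≤ _ := by rw [one_pow]; gcongr
    refine ⟨?_, ?_⟩
    · have : Measurable fun x => ∑' n, F n x := by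
        refine Measurable.tsum fun n => ?_
        have : F n = fun x => (b (n + 1) / (n + 1).factorial) * |x| ^ (n + 2) := funext (hFe n)
        rw [this]; fun_prop
      exact this.aestronglyMeasurable
    · rw [hasFiniteIntegral_iff_enorm]
      calc ∫⁻ x, ‖∑' n, F n x‖ₑ ∂μ ≤ ∫⁻ x, ∑' n, ‖F n x‖ₑ ∂μ :=
            lintegral_mono fun x => enorm_tsum_le_tsum_enorm
        _ = ∑' n, ∫⁻ x, ‖F n x‖ₑ ∂μ :=
            lintegral_tsum fun n => (hFi n).1.enorm
        _ = ∑' n, ENNReal.ofReal (∫ x, ‖F n x‖ ∂μ) := by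
            congr 1; funext n; rw [ofReal_integral_norm_eq_lintegral_enorm (hFi n)]
        _ < ⊤ := hIs.tsum_ofReal_lt_top

/-- The distribution function of a convolution. -/
lemma cdf_conv_eq (μ ζ : Measure ℝ) [IsProbabilityMeasure μ] [IsProbabilityMeasure ζ] (t : ℝ) :
    cdf (μ.conv ζ) t = ∫ x, cdf ζ (t - x) ∂μ := by
  have hm : Measurable fun x => cdf ζ (t - x) :=
    (monotone_cdf ζ).measurable.comp (by fun_prop)
  rw [cdf_eq_real, measureReal_def,
    integral_eq_lintegral_of_nonneg_ae (Filter.Eventually.of_forall fun x => cdf_nonneg ζ _)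
      hm.aestronglyMeasurable]
  congr 1
  rw [← lintegral_indicator_one measurableSet_Iic, Measure.lintegral_conv
    (measurable_one.indicator measurableSet_Iic)]
  refine lintegral_congr fun x => ?_
  rw [ofReal_cdf, ← lintegral_indicator_one measurableSet_Iic]
  refine lintegral_congr fun y => ?_
  simp only [Set.indicator, Set.mem_Iic, le_sub_iff_add_le', Pi.one_apply]

/-- The noise measure: a density that varies slowly relative to `H`. -/
lemma exists_noise (H : ℝ → ℝ) (e : ℝ) (he : 0 < e)
    (h1 : ∀ x, 0 ≤ x → 1 ≤ H x) (hmono : ∀ x y, 0 ≤ x → x ≤ y → H x ≤ H y)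
    (hsub : ∀ x y, 0 ≤ x → 0 ≤ y → H (x + y) ≤ H x * H y)
    (hpow : ∀ n : ℕ, ∃ c > 0, ∀ x, 0 ≤ x → c * x ^ n ≤ H x) :
    ∃ ζ : Measure ℝ, IsProbabilityMeasure ζ ∧ HasAllMoments ζ ∧
      ∃ f : ℝ → ℝ, (∀ t, 0 < f t) ∧ ∀ t x,
        |cdf ζ t - cdf ζ (t - x) - f t * x| ≤ f t * (|x| * (H (e * |x|) - 1)) := by
  set g : ℝ → ℝ := fun t => (H (e * |t|))⁻¹ with hg
  have hnn : ∀ t : ℝ, 0 ≤ e * |t| := fun t => by positivity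
  have hHpos : ∀ t : ℝ, 0 < H (e * |t|) := fun t => zero_lt_one.trans_le (h1 _ (hnn t))
  have hgpos : ∀ t, 0 < g t := fun t => inv_pos.2 (hHpos t)
  have hgm : Measurable g := by
    have hm : Monotone fun x => H (max x 0) := fun x y hxy =>
      hmono _ _ (le_max_right _ _) (max_le_max_right 0 hxy)
    have : g = fun t => ((fun x => H (max x 0)) (e * |t|))⁻¹ := by
      funext t; simp only [hg, max_eq_left (hnn t)]
    rw [this]
    exact (hm.measurable.comp (by fun_prop : Measurable fun t : ℝ => e * |t|)).inv
  have hgi : ∀ n : ℕ, Integrable (fun t => |t| ^ n * g t) := by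
    intro n
    obtain ⟨c, hc, hcn⟩ := hpow n
    obtain ⟨d, hd, hdn⟩ := hpow (n + 2)
    refine (integrable_inv_one_add_sq.const_mul
      ((c * e ^ n)⁻¹ + (d * e ^ (n + 2))⁻¹)).mono' (by fun_prop) ?_
    refine Filter.Eventually.of_forall fun t => ?_
    have hp : 0 ≤ |t| ^ n * g t := mul_nonneg (by positivity) (hgpos t).le
    rw [Real.norm_of_nonneg hp]
    have hA : |t| ^ n ≤ (c * e ^ n)⁻¹ * H (e * |t|) := by
      rw [inv_mul_eq_div, le_div_iff₀ (by positivity)]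
      have := hcn _ (hnn t)
      rw [mul_pow] at this; linarith
    have hB : |t| ^ (n + 2) ≤ (d * e ^ (n + 2))⁻¹ * H (e * |t|) := by
      rw [inv_mul_eq_div, le_div_iff₀ (by positivity)]
      have := hdn _ (hnn t)
      rw [mul_pow] at this; linarith
    rw [← div_eq_mul_inv _ (1 + t ^ 2), le_div_iff₀ (by positivity)]
    have : |t| ^ n * g t * (1 + t ^ 2) = (|t| ^ n + |t| ^ (n + 2)) * g t := by
      rw [← sq_abs t]; ring
    rw [this]
    calc _ ≤ ((c * e ^ n)⁻¹ * H (e * |t|) + (d * e ^ (n + 2))⁻¹ * H (e * |t|)) * g t :=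
          mul_le_mul_of_nonneg_right (add_le_add hA hB) (hgpos t).le
      _ = _ := by
          simp only [hg]
          rw [← add_mul, mul_assoc, mul_inv_cancel₀ (hHpos t).ne', mul_one]
  have hgI : Integrable g := by simpa using hgi 0
  have hZ : 0 < ∫ t, g t := by
    rw [integral_pos_iff_support_of_nonneg (fun t => (hgpos t).le) hgI]
    have : Function.support g = Set.univ := by
      ext t; simp [(hgpos t).ne']
    rw [this]; simp
  set Z := ∫ t, g t with hZdef
  set f : ℝ → ℝ := fun t => Z⁻¹ * g t with hf
  have hfpos : ∀ t, 0 < f t := fun t => mul_pos (inv_pos.2 hZ) (hgpos t)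
  have hfm : Measurable f := hgm.const_mul _
  have hfI : Integrable f := hgI.const_mul _
  have hf1 : ∫ t, f t = 1 := by
    simp only [hf]; rw [integral_const_mul, ← hZdef, inv_mul_cancel₀ hZ.ne']
  have hprob : IsProbabilityMeasure (volume.withDensity fun t => ENNReal.ofReal (f t)) := by
    refine ⟨?_⟩
    rw [withDensity_apply _ MeasurableSet.univ, setLIntegral_univ,
      ← ofReal_integral_eq_lintegral_ofReal hfI (Filter.Eventually.of_forall fun t => (hfpos t).le),
      hf1, ENNReal.ofReal_one]
  have hcdf : ∀ t, cdf (volume.withDensity fun t => ENNReal.ofReal (f t)) t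
      = ∫ s in Set.Iic t, f s := by
    intro t
    rw [cdf_eq_real, measureReal_def, withDensity_apply _ measurableSet_Iic,
      integral_eq_lintegral_of_nonneg_ae (Filter.Eventually.of_forall fun t => (hfpos t).le)
        hfm.aestronglyMeasurable]
  refine ⟨volume.withDensity fun t => ENNReal.ofReal (f t), hprob, ?_, f, hfpos, ?_⟩
  · intro n
    rw [integrable_withDensity_iff_integrable_smul' hfm.ennreal_ofReal
      (Filter.Eventually.of_forall fun t => ENNReal.ofReal_lt_top)]
    have : (fun t => (ENNReal.ofReal (f t)).toReal • |t| ^ n)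
        = fun t => Z⁻¹ * (|t| ^ n * g t) := by
      funext t
      rw [ENNReal.toReal_ofReal (hfpos t).le, smul_eq_mul]
      simp only [hf]; ring
    rw [this]
    exact (hgi n).const_mul _
  · intro t x
    have hfii : ∀ u v, IntervalIntegrable f volume u v := fun u v => hfI.intervalIntegrable
    rw [hcdf, hcdf, intervalIntegral.integral_Iic_sub_Iic hfI.integrableOn hfI.integrableOn]
    have hconst : f t * x = ∫ s in (t - x)..t, f t := by
      rw [intervalIntegral.integral_const, smul_eq_mul]; ring
    rw [hconst, ← intervalIntegral.integral_sub (hfii _ _) intervalIntegrable_const]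
    -- slow variation
    have key : ∀ s y, |s - t| ≤ |y| → |f s - f t| ≤ f t * (H (e * |y|) - 1) := by
      intro s y hy
      have hK := h1 _ (hnn y)
      have hcomp : ∀ p q : ℝ, |p - q| ≤ |y| → H (e * |p|) ≤ H (e * |q|) * H (e * |y|) := by
        intro p q hpq
        refine (hmono _ (e * |q| + e * |y|) (hnn p) ?_).trans (hsub _ _ (hnn q) (hnn y))
        rw [← mul_add]
        gcongr
        have := abs_add_le q (p - q)
        rw [add_sub_cancel] at this
        linarith
      have hg2 : ∀ p q : ℝ, |p - q| ≤ |y| → f q ≤ f p * H (e * |y|) := by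
        intro p q hpq
        have h := hcomp p q hpq
        simp only [hf, hg]
        rw [mul_assoc]
        refine mul_le_mul_of_nonneg_left ?_ (inv_pos.2 hZ).le
        rw [inv_mul_eq_div, le_div_iff₀ (hHpos p), inv_mul_le_iff₀ (hHpos q)]
        exact h
      have hu := hg2 t s (by rw [abs_sub_comm]; exact hy)
      have hl := hg2 s t hy
      have hft := hfpos t
      have hfs := hfpos s
      rw [abs_le]
      constructor
      · nlinarith
      · linarith
    have hb := intervalIntegral.norm_integral_le_of_norm_le_const (a := t - x) (b := t)
      (f := fun s => f s - f t) (C := f t * (H (e * |x|) - 1)) (fun s hs => by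
        rw [Real.norm_eq_abs]
        apply key
        rcases Set.mem_uIoc.1 hs with ⟨ha, hb⟩ | ⟨ha, hb⟩
        · rw [abs_le]; constructor <;>
            cases abs_cases x <;> linarith
        · rw [abs_le]; constructor <;>
            cases abs_cases x <;> linarith)
    rw [Real.norm_eq_abs] at hb
    refine hb.trans (le_of_eq ?_)
    rw [sub_sub_cancel]; ring

theorem stmt_4 (k : ℕ) (μ : Fin k → Measure ℝ)
    (hprob : ∀ i, IsProbabilityMeasure (μ i)) (hmom : ∀ i, HasAllMoments (μ i))
    (hmean : ∀ i j : Fin k, j < i → (∫ x, x ∂(μ j)) < ∫ x, x ∂(μ i)) :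
    ∃ ζ : Measure ℝ, IsProbabilityMeasure ζ ∧ HasAllMoments ζ ∧
      ∀ i j : Fin k, j < i → StrictFSD ((μ i).conv ζ) ((μ j).conv ζ) := by
  have hInt1 : ∀ i, Integrable (fun x : ℝ => x) (μ i) := fun i => by
    have h := hmom i 1
    simp only [pow_one] at h
    exact (integrable_norm_iff (by fun_prop)).1 h
  set M : ℕ → ℝ := fun n => ∑ i, ∫ x, |x| ^ n ∂(μ i) with hMdef
  have hin : ∀ i n, 0 ≤ ∫ x, |x| ^ n ∂(μ i) := fun i n =>
    integral_nonneg fun x => by positivity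
  have hM : ∀ n, 0 ≤ M n := fun n => Finset.sum_nonneg fun i _ => hin i n
  obtain ⟨H, h1, hmono, hsub, hscale, hpow, hHi⟩ := exists_H M hM
  have hHint : ∀ i, Integrable (fun x => |x| * (H |x| - 1)) (μ i) := fun i =>
    hHi (μ i) (hmom i) fun n =>
      Finset.single_le_sum (f := fun i => ∫ x, |x| ^ n ∂(μ i)) (fun i _ => hin i n)
        (Finset.mem_univ i)
  set K : Fin k → ℝ := fun i => ∫ x, |x| * (H |x| - 1) ∂(μ i) with hK
  have hsmall : ∀ p : Fin k × Fin k, ∀ᶠ e : ℝ in nhdsWithin 0 (Set.Ioi 0),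
      p.2 < p.1 → e * (K p.1 + K p.2) < (∫ x, x ∂(μ p.1)) - ∫ x, x ∂(μ p.2) := by
    intro p
    by_cases hp : p.2 < p.1
    · have ht : Filter.Tendsto (fun e : ℝ => e * (K p.1 + K p.2)) (nhdsWithin 0 (Set.Ioi 0))
          (nhds (0 * (K p.1 + K p.2))) :=
        ((continuous_id.mul continuous_const).tendsto 0).mono_left nhdsWithin_le_nhds
      rw [zero_mul] at ht
      filter_upwards [ht.eventually_lt_const (sub_pos.2 (hmean p.1 p.2 hp))] with e he _ using he
    · exact Filter.Eventually.of_forall fun e h => absurd h hp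
  have hle1 : ∀ᶠ e : ℝ in nhdsWithin 0 (Set.Ioi 0), e ≤ 1 :=
    nhdsWithin_le_nhds (Iic_mem_nhds zero_lt_one)
  obtain ⟨e, ⟨hes, he1⟩, he0⟩ :=
    (((Filter.eventually_all.2 hsmall).and hle1).and self_mem_nhdsWithin).exists
  have he0 : 0 < e := he0
  obtain ⟨ζ, hζp, hζm, f, hf, hζ⟩ := exists_noise H e he0 h1 hmono hsub hpow
  refine ⟨ζ, hζp, hζm, ?_⟩
  have hest : ∀ i t, |cdf ζ t - cdf ((μ i).conv ζ) t - f t * ∫ x, x ∂(μ i)|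
      ≤ f t * (e * K i) := by
    intro i t
    have := hprob i
    have hci : Integrable (fun x => cdf ζ (t - x)) (μ i) := by
      refine Integrable.of_bound
        ((monotone_cdf ζ).measurable.comp (by fun_prop)).aestronglyMeasurable 1 ?_
      refine Filter.Eventually.of_forall fun x => ?_
      rw [Real.norm_of_nonneg (cdf_nonneg ζ _)]
      exact cdf_le_one ζ _
    have heq : cdf ζ t - cdf ((μ i).conv ζ) t - f t * ∫ x, x ∂(μ i)
        = ∫ x, (cdf ζ t - cdf ζ (t - x) - f t * x) ∂(μ i) := by
      have hd : Integrable (fun x => cdf ζ t - cdf ζ (t - x)) (μ i) := (integrable_const _).sub hci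
      rw [integral_sub hd ((hInt1 i).const_mul _),
        integral_sub (integrable_const _) hci, integral_const_mul, cdf_conv_eq]
      simp
    rw [heq, hK]
    simp only
    rw [← integral_const_mul, ← integral_const_mul, ← Real.norm_eq_abs]
    refine norm_integral_le_of_norm_le (((hHint i).const_mul e).const_mul (f t)) ?_
    refine Filter.Eventually.of_forall fun x => ?_
    rw [Real.norm_eq_abs]
    refine (hζ t x).trans (mul_le_mul_of_nonneg_left ?_ (hf t).le)
    calc _ ≤ |x| * (e * (H |x| - 1)) :=
          mul_le_mul_of_nonneg_left (hscale e |x| he0.le he1 (abs_nonneg x)) (abs_nonneg x)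
      _ = _ := by ring
  intro i j hij
  have hlt : ∀ t, cdf ((μ i).conv ζ) t < cdf ((μ j).conv ζ) t := by
    intro t
    have a1 := (abs_le.1 (hest i t)).1
    have a2 := (abs_le.1 (hest j t)).2
    have a3 := mul_lt_mul_of_pos_left (hes (i, j) hij) (hf t)
    simp only at a3
    nlinarith
  exact ⟨fun t => (hlt t).le, fun h => (h ▸ hlt 0).ne rfl⟩
end

section
/- Let μ and ν be Borel probability measures on ℝ with finite first moments such that ∫x dμ(x) > ∫x dν(x). Then for every ε ∈ (0,1) there exist σ² > 0 and a Borel probability measure H on ℝ such that the mixture η = (1 − ε)·G + ε·H, where G is the Gaussian measure on ℝ with mean 0 and variance σ², satisfies μ ∗ η >₁ ν ∗ η. -/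
open MeasureTheory ProbabilityTheory
open scoped NNReal ENNReal

noncomputable def gphi (s : ℝ) : ℝ := gaussianPDFReal 0 1 s
noncomputable def gPhi (s : ℝ) : ℝ := cdf (gaussianReal 0 1) s

lemma gphi_eq (s : ℝ) : gphi s = (√(2 * Real.pi))⁻¹ * Real.exp (-s ^ 2 / 2) := by
  simp [gphi, gaussianPDFReal]

lemma gphi_pos (s : ℝ) : 0 < gphi s := gaussianPDFReal_pos _ _ _ one_ne_zero

lemma gphi_const : (√(2 * Real.pi))⁻¹ ≤ 1 := by
  apply inv_le_one_of_one_le₀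
  rw [Real.one_le_sqrt]
  nlinarith [Real.pi_gt_three]

lemma gphi_deriv (s : ℝ) : HasDerivAt gphi (-s * gphi s) s := by
  have h1 : HasDerivAt (fun s : ℝ => -s ^ 2 / 2) (-s) s := by
    have := (hasDerivAt_pow 2 s).neg.div_const 2
    refine this.congr_deriv ?_
    push_cast; ring
  have := (h1.exp).const_mul (√(2 * Real.pi))⁻¹
  have e : gphi = fun s => (√(2 * Real.pi))⁻¹ * Real.exp (-s ^ 2 / 2) := funext gphi_eq
  rw [e]
  refine this.congr_deriv ?_
  ring

lemma gphi_cont : Continuous gphi :=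
  continuous_iff_continuousAt.2 fun s => (gphi_deriv s).continuousAt

lemma gPhi_eq (s : ℝ) : gPhi s = ∫ x in Set.Iic s, gphi x := by
  rw [gPhi, cdf_eq_real, Measure.real, gaussianReal_apply_eq_integral _ one_ne_zero,
    ENNReal.toReal_ofReal]
  · rfl
  · exact integral_nonneg fun x => (gphi_pos x).le

lemma gPhi_deriv (s : ℝ) : HasDerivAt gPhi (gphi s) s := by
  have hi : Integrable gphi := integrable_gaussianPDFReal 0 1
  have e : gPhi = fun s => gPhi 0 + ∫ x in (0:ℝ)..s, gphi x := by
    ext s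
    rw [← intervalIntegral.integral_Iic_sub_Iic hi.integrableOn hi.integrableOn, gPhi_eq, gPhi_eq]
    ring
  rw [e]
  exact (gphi_cont.integral_hasStrictDerivAt 0 s).hasDerivAt.const_add _

lemma exp_low (x : ℝ) : 8 * Real.exp (-x ^ 2 / 2) * (1 + x^2) ^ 2 ≤ 64 := by
  have h : 1 + x^2/2 + (x^2/2)^2/2 ≤ Real.exp (x^2/2) := Real.quadratic_le_exp_of_nonneg (by positivity)
  have h2 : Real.exp (-x ^ 2 / 2) * Real.exp (x^2/2) = 1 := by
    rw [← Real.exp_add]; ring_nf; simp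
  have h3 := Real.exp_pos (-x^2/2)
  have : (1 + x^2)^2 ≤ 8 * Real.exp (x^2/2) := by nlinarith [sq_nonneg x]
  calc _ ≤ 8 * Real.exp (-x ^ 2 / 2) * (8 * Real.exp (x^2/2)) := by gcongr
    _ = 64 := by linear_combination 64 * h2

lemma gphi_bound (w x : ℝ) (h : |w| ≤ 2 * |x| + 2) : gphi x ≤ 72 / (1 + w ^ 2) := by
  rw [le_div_iff₀ (by positivity)]
  have h1 := exp_low x
  have h2 : gphi x ≤ Real.exp (-x ^ 2 / 2) := by
    rw [gphi_eq]; exact mul_le_of_le_one_left (Real.exp_pos _).le gphi_const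
  have hw : 1 + w^2 ≤ 9 * (1 + x^2) := by
    rw [← sq_abs w, ← sq_abs x]
    nlinarith [abs_nonneg w, abs_nonneg x, sq_nonneg (|x| - 1), sq_nonneg (2*|x| - 2)]
  have h3 := Real.exp_pos (-x^2/2)
  calc _ ≤ Real.exp (-x ^ 2 / 2) * (9 * (1 + x^2)) := by gcongr
    _ ≤ Real.exp (-x ^ 2 / 2) * (9 * (1 + x^2)^2) := by
        gcongr; nlinarith [sq_nonneg x, sq_nonneg (x^2)]
    _ ≤ 72 := by linarith

lemma gphi'_bound (w x : ℝ) (h : |w| ≤ 2 * |x| + 2) : |-x * gphi x| ≤ 72 / (1 + w ^ 2) := by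
  rw [le_div_iff₀ (by positivity), abs_mul, abs_neg, abs_of_pos (gphi_pos x)]
  have h1 := exp_low x
  have h2 : gphi x ≤ Real.exp (-x ^ 2 / 2) := by
    rw [gphi_eq]; exact mul_le_of_le_one_left (Real.exp_pos _).le gphi_const
  have hw : 1 + w^2 ≤ 9 * (1 + x^2) := by
    rw [← sq_abs w, ← sq_abs x]
    nlinarith [abs_nonneg w, abs_nonneg x, sq_nonneg (|x| - 1), sq_nonneg (2*|x| - 2)]
  have h3 := Real.exp_pos (-x^2/2)
  have h4 : |x| ≤ (1 + x^2) := by rw [← sq_abs x]; nlinarith [sq_nonneg (|x| - 1), abs_nonneg x]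
  have h5 := gphi_pos x
  calc _ ≤ (1 + x^2) * Real.exp (-x ^ 2 / 2) * (9 * (1 + x^2)) := by gcongr
    _ ≤ 72 := by linarith

lemma mvt_bound (f f' : ℝ → ℝ) (hf : ∀ x, HasDerivAt f (f' x) x) (C a b : ℝ)
    (h : ∀ x ∈ Set.uIcc a b, |f' x| ≤ C) : |f b - f a| ≤ C * |b - a| := by
  have := (convex_uIcc a b).norm_image_sub_le_of_norm_hasDerivWithin_le
    (f := f) (f' := f') (C := C) (fun x _ => (hf x).hasDerivWithinAt) (fun x hx => h x hx)
    Set.left_mem_uIcc Set.right_mem_uIcc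
  simpa using this

lemma gPhi_mem (s : ℝ) : 0 ≤ gPhi s ∧ gPhi s ≤ 1 := ⟨cdf_nonneg _ _, cdf_le_one _ _⟩

noncomputable def rem (s u : ℝ) : ℝ := gPhi (s - u) - gPhi s + u * gphi s

noncomputable def KK (w u : ℝ) : ℝ := 144 * (|u| * min 1 |u|) * (1 + w ^ 2)⁻¹ +
  (if 1 < |u| ∧ |w| ≤ 2 * |u| then 1 else 0)

lemma abs_uIcc {a b x : ℝ} (h : x ∈ Set.uIcc a b) : |x - a| ≤ |b - a| := Set.abs_sub_left_of_mem_uIcc h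

lemma rem_bound (s w u : ℝ) (h1 : w ≤ s) (h2 : s ≤ w + 1) : |rem s u| ≤ KK w u := by
  have hsw : |w| ≤ |s| + 1 := by
    rcases abs_cases w with h | h <;> rcases abs_cases s with h' | h' <;> linarith
  have hden : 0 < (1 + w^2)⁻¹ := by positivity
  unfold rem KK
  have hu0 := abs_nonneg u
  by_cases hu : |u| ≤ 1
  · rw [min_eq_right hu, if_neg (by intro h; linarith [h.1]), add_zero]
    have hd : ∀ v, HasDerivAt (fun v => gPhi (s - v) + v * gphi s) (gphi s - gphi (s - v)) v := by
      intro v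
      have h := (gPhi_deriv (s - v)).comp_const_sub s v
      have h' := (hasDerivAt_id v).mul_const (gphi s)
      refine (h.add h').congr_deriv ?_
      ring
    have := mvt_bound _ _ hd (72 / (1 + w^2) * |u|) 0 u ?_
    · simp only [sub_zero, zero_mul, add_zero] at this
      have e : gPhi (s - u) - gPhi s + u * gphi s = gPhi (s - u) + u * gphi s - gPhi s := by ring
      rw [e]
      refine this.trans ?_
      rw [div_eq_mul_inv]
      have : 0 ≤ |u| * |u| * (1 + w^2)⁻¹ := by positivity
      nlinarith
    · intro v hv
      have hv' : |v| ≤ |u| := by simpa using abs_uIcc hv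
      have := mvt_bound _ _ gphi_deriv (72 / (1 + w^2)) (s - v) s ?_
      · refine this.trans ?_
        rw [sub_sub_cancel]; gcongr
      · intro x hx
        apply gphi'_bound
        rw [Set.uIcc_comm] at hx
        have hx' : |x - s| ≤ |v| := by simpa using abs_uIcc hx
        have : |s| ≤ |x| + |x - s| := by
          have := abs_sub_abs_le_abs_sub s x
          rw [abs_sub_comm] at this; linarith
        have := abs_nonneg x
        linarith
  · push Not at hu
    rw [min_eq_left hu.le]
    have hb : |u * gphi s| ≤ 72 * |u| * (1 + w^2)⁻¹ := by
      rw [abs_mul, abs_of_pos (gphi_pos s)]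
      have := gphi_bound w s (by linarith [abs_nonneg s])
      rw [div_eq_mul_inv] at this
      nlinarith
    refine (abs_add_le _ _).trans ?_
    by_cases hw : |w| ≤ 2 * |u|
    · rw [if_pos ⟨hu, hw⟩]
      have : |gPhi (s - u) - gPhi s| ≤ 1 := by
        have := gPhi_mem s; have := gPhi_mem (s - u)
        rw [abs_le]; constructor <;> linarith
      have : 0 ≤ |u| * (1 + w^2)⁻¹ := by positivity
      nlinarith
    · rw [if_neg (by tauto)]
      push Not at hw
      have := mvt_bound _ _ gPhi_deriv (72 / (1 + w^2)) s (s - u) ?_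
      · rw [sub_sub_cancel_left, abs_neg, div_eq_mul_inv] at this
        nlinarith
      · intro x hx
        rw [abs_of_pos (gphi_pos x)]
        apply gphi_bound
        have hx' : |x - s| ≤ |u| := by simpa using abs_uIcc hx
        have : |s| ≤ |x| + |x - s| := by
          have := abs_sub_abs_le_abs_sub s x
          rw [abs_sub_comm] at this; linarith
        linarith

lemma measurable_Iic_sub (α : Measure ℝ) (t : ℝ) : Measurable (fun x : ℝ => α (Set.Iic (t - x))) := by
  have : Antitone (fun x : ℝ => α (Set.Iic (t - x))) := fun a b hab =>
    measure_mono (Set.Iic_subset_Iic.2 (by linarith))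
  exact this.measurable

lemma conv_Iic (α κ : Measure ℝ) [SFinite α] [SFinite κ] (t : ℝ) :
    (α.conv κ) (Set.Iic t) = ∫⁻ x, α (Set.Iic (t - x)) ∂κ := by
  rw [Measure.conv_comm, ← lintegral_indicator_one measurableSet_Iic,
    Measure.lintegral_conv (measurable_one.indicator measurableSet_Iic)]
  refine lintegral_congr fun x => ?_
  rw [← lintegral_indicator_one measurableSet_Iic]
  refine lintegral_congr fun y => ?_
  simp only [Set.indicator, Set.mem_Iic, le_sub_iff_add_le', Pi.one_apply]

/-- convolution powers -/
noncomputable def cpow (Q : Measure ℝ) : ℕ → Measure ℝ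
  | 0 => Measure.dirac 0
  | n + 1 => Q.conv (cpow Q n)

lemma conv_univ (Q R : Measure ℝ) [SFinite Q] [SFinite R] :
    (Q.conv R) Set.univ = Q Set.univ * R Set.univ := by
  rw [Measure.conv, Measure.map_apply (by fun_prop) MeasurableSet.univ, Set.preimage_univ,
    ← Set.univ_prod_univ, Measure.prod_prod]

instance cpow_finite (Q : Measure ℝ) [IsFiniteMeasure Q] (n : ℕ) : IsFiniteMeasure (cpow Q n) := by
  induction n with
  | zero => unfold cpow; infer_instance
  | succ n ih => unfold cpow; infer_instance

lemma cpow_univ (Q : Measure ℝ) [IsFiniteMeasure Q] (n : ℕ) :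
    cpow Q n Set.univ = (Q Set.univ) ^ n := by
  induction n with
  | zero => simp [cpow]
  | succ n ih => rw [cpow, conv_univ, ih, pow_succ']

lemma exists_renewal (Q : Measure ℝ) [IsFiniteMeasure Q] (hQ : Q Set.univ < 1) :
    ∃ κ : Measure ℝ, κ Set.univ = (1 - Q Set.univ)⁻¹ ∧ IsFiniteMeasure κ ∧
      κ = Measure.dirac 0 + Q.conv κ := by
  refine ⟨Measure.sum (cpow Q), ?_, ?_, ?_⟩
  · rw [Measure.sum_apply _ MeasurableSet.univ]
    simp_rw [cpow_univ]
    exact ENNReal.tsum_geometric _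
  · constructor
    rw [Measure.sum_apply _ MeasurableSet.univ]
    simp_rw [cpow_univ]
    rw [ENNReal.tsum_geometric, ENNReal.inv_lt_top]
    exact tsub_pos_of_lt hQ
  · have : Q.conv (Measure.sum (cpow Q)) = Measure.sum (fun n => cpow Q (n+1)) := by
      rw [Measure.conv, Measure.prod_sum_right, Measure.map_sum (by fun_prop)]
      rfl
    rw [this]
    ext s hs
    rw [Measure.add_apply, Measure.sum_apply _ hs, Measure.sum_apply _ hs, tsum_eq_zero_add' ENNReal.summable]
    rfl

lemma neumann (Q α β : Measure ℝ) [IsFiniteMeasure Q] [IsProbabilityMeasure α]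
    [IsProbabilityMeasure β] (κ : Measure ℝ) [IsFiniteMeasure κ]
    (hκ : κ = Measure.dirac 0 + Q.conv κ)
    (h : ∀ t, α (Set.Iic t) - β (Set.Iic t) ≤
      ∫⁻ x, (β (Set.Iic (t - x)) - α (Set.Iic (t - x))) ∂Q) (t : ℝ) :
    (α.conv κ) (Set.Iic t) + (β (Set.Iic t) - α (Set.Iic t)) ≤ (β.conv κ) (Set.Iic t) := by
  rw [conv_Iic, conv_Iic]
  have ma := measurable_Iic_sub α
  have mb := measurable_Iic_sub β
  set p : ℝ → ℝ≥0∞ := fun t => β (Set.Iic t) - α (Set.Iic t) with hp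
  set n : ℝ → ℝ≥0∞ := fun t => α (Set.Iic t) - β (Set.Iic t) with hn
  have mp : Measurable p := by
    have := (mb 0).sub (ma 0)
    have := this.comp measurable_neg
    convert this using 1
    ext x; simp [hp]
  have mp' : ∀ t, Measurable (fun x => p (t - x)) := fun t => mp.comp (by fun_prop)
  have mn : Measurable n := by
    have := (ma 0).sub (mb 0)
    have := this.comp measurable_neg
    convert this using 1
    ext x; simp [hn]
  have mn' : ∀ t, Measurable (fun x => n (t - x)) := fun t => mn.comp (by fun_prop)
  have key : ∫⁻ x, n (t - x) ∂κ + p t ≤ ∫⁻ x, p (t - x) ∂κ := by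
    have e1 : ∫⁻ x, p (t - x) ∂κ = p t + ∫⁻ x, p (t - x) ∂(Q.conv κ) := by
      conv_lhs => rw [hκ]
      rw [lintegral_add_measure, lintegral_dirac' _ (mp' t)]
      simp
    rw [e1, add_comm]
    refine add_le_add le_rfl ?_
    rw [Measure.conv_comm, Measure.lintegral_conv (mp' t)]
    refine lintegral_mono fun x => ?_
    refine (h (t - x)).trans (le_of_eq ?_)
    refine lintegral_congr fun y => ?_
    simp only [hp]
    rw [sub_add_eq_sub_sub]
  have ident : ∫⁻ x, α (Set.Iic (t - x)) ∂κ + ∫⁻ x, p (t - x) ∂κ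
      = ∫⁻ x, β (Set.Iic (t - x)) ∂κ + ∫⁻ x, n (t - x) ∂κ := by
    rw [← lintegral_add_left (ma t), ← lintegral_add_left (mb t)]
    refine lintegral_congr fun x => ?_
    simp only [hp, hn]
    rw [add_tsub_eq_max, add_tsub_eq_max, max_comm]
  have fin : ∫⁻ x, n (t - x) ∂κ ≠ ∞ := by
    refine ne_of_lt (lt_of_le_of_lt (lintegral_mono (g := fun _ => 1) fun x => ?_) ?_)
    · exact tsub_le_self.trans prob_le_one
    · simp
  refine (ENNReal.add_le_add_iff_right fin).1 ?_
  rw [← ident]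
  calc _ = ∫⁻ x, α (Set.Iic (t - x)) ∂κ + (∫⁻ x, n (t - x) ∂κ + p t) := by ring
    _ ≤ _ := by gcongr

lemma assemble (μ ν G Q : Measure ℝ) [IsProbabilityMeasure μ] [IsProbabilityMeasure ν]
    [IsProbabilityMeasure G] (ε : ℝ) (hε : ε ∈ Set.Ioo (0 : ℝ) 1)
    (hQ : Q Set.univ ≤ ENNReal.ofReal ε)
    (h : ∀ t, (μ.conv G) (Set.Iic t) - (ν.conv G) (Set.Iic t) ≤
      ∫⁻ x, ((ν.conv G) (Set.Iic (t - x)) - (μ.conv G) (Set.Iic (t - x))) ∂Q)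
    (h0 : (μ.conv G) (Set.Iic 0) < (ν.conv G) (Set.Iic 0)) :
    ∃ H : Measure ℝ, IsProbabilityMeasure H ∧
      ((∀ t : ℝ, cdf (μ.conv (ENNReal.ofReal (1 - ε) • G + ENNReal.ofReal ε • H)) t ≤
        cdf (ν.conv (ENNReal.ofReal (1 - ε) • G + ENNReal.ofReal ε • H)) t) ∧ 
        (μ.conv (ENNReal.ofReal (1 - ε) • G + ENNReal.ofReal ε • H)) ≠
        (ν.conv (ENNReal.ofReal (1 - ε) • G + ENNReal.ofReal ε • H))) := by
  obtain ⟨he0, he1⟩ := hε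
  set Q' : Measure ℝ := Q + (ENNReal.ofReal ε - Q Set.univ) • Measure.dirac 0 with hQ'
  have hQ'u : Q' Set.univ = ENNReal.ofReal ε := by
    simp [hQ', add_tsub_cancel_of_le hQ]
  have : IsFiniteMeasure Q' := ⟨by rw [hQ'u]; exact ENNReal.ofReal_lt_top⟩
  obtain ⟨κ, hκu, hκf, hκ⟩ := exists_renewal Q' (by rw [hQ'u]; simpa using he1)
  have h1e : 1 - ENNReal.ofReal ε = ENNReal.ofReal (1 - ε) := by
    rw [ENNReal.ofReal_sub _ he0.le, ENNReal.ofReal_one]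
  rw [hQ'u, h1e] at hκu
  have a0 : ENNReal.ofReal (1 - ε) ≠ 0 := by simpa using he1
  have b0 : ENNReal.ofReal ε ≠ 0 := by simpa using he0
  set a := ENNReal.ofReal (1 - ε) with ha
  set b := ENNReal.ofReal ε with hb
  have at' : a ≠ ∞ := ENNReal.ofReal_ne_top
  have bt : b ≠ ∞ := ENNReal.ofReal_ne_top
  set H : Measure ℝ := (a * b⁻¹) • (G.conv (Q'.conv κ)) with hH
  have hHp : IsProbabilityMeasure H := by
    constructor
    simp only [hH, Measure.smul_apply, conv_univ, hQ'u, hκu, measure_univ, smul_eq_mul, one_mul]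
    rw [mul_assoc, ← mul_assoc b⁻¹, ENNReal.inv_mul_cancel b0 bt, one_mul, ENNReal.mul_inv_cancel a0 at']
  have hη : a • G + b • H = a • (G.conv κ) := by
    conv_rhs => rw [hκ, Measure.conv_add, Measure.conv_dirac_zero]
    rw [hH, smul_add, smul_smul, mul_comm a, ← mul_assoc, ENNReal.mul_inv_cancel b0 bt, one_mul]
  refine ⟨H, hHp, ?_⟩
  have hηp : IsProbabilityMeasure (a • G + b • H) := by
    constructor
    simp only [Measure.add_apply, Measure.smul_apply, measure_univ, smul_eq_mul, mul_one, ha, hb]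
    rw [← ENNReal.ofReal_add (by linarith) he0.le]; simp
  have hc : ∀ ρ : Measure ℝ, IsProbabilityMeasure ρ → 
      ρ.conv (a • G + b • H) = a • ((ρ.conv G).conv κ) := by
    intro ρ _
    rw [hη, Measure.conv_comm, Measure.conv_smul_left, Measure.conv_comm, Measure.conv_assoc]
  have hN := neumann Q' (μ.conv G) (ν.conv G) κ hκ (fun t => (h t).trans (by
    rw [hQ', lintegral_add_measure]; exact le_self_add))
  constructor
  · intro t
    rw [cdf_eq_real, cdf_eq_real]
    refine ENNReal.toReal_mono (measure_ne_top _ _) ?_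
    rw [hc μ inferInstance, hc ν inferInstance]
    simp only [Measure.smul_apply, smul_eq_mul]
    exact mul_le_mul_right (le_self_add.trans (hN t)) _
  · intro heq
    have := congrArg (fun m => m (Set.Iic (0:ℝ))) heq
    rw [hc μ inferInstance, hc ν inferInstance] at this
    simp only [Measure.smul_apply, smul_eq_mul] at this
    rw [ENNReal.mul_right_inj a0 at'] at this
    have h2 := hN 0
    rw [← this] at h2
    have h3 := tsub_pos_of_lt h0
    exact absurd h2 (not_le.2 (ENNReal.lt_add_right (measure_ne_top _ _) h3.ne'))

lemma exists_sigma (l : Measure ℝ) (hl : Integrable (fun x : ℝ => x) l) (δ : ℝ) (hδ : 0 < δ) :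
    ∃ σ : ℝ, 0 < σ ∧ ∫ x, |x| * min 1 |x / σ| ∂l ≤ δ := by
  have : Filter.Tendsto (fun n : ℕ => ∫ x, |x| * min 1 |x / ((n:ℝ) + 1)| ∂l) Filter.atTop
      (nhds (∫ x, (0:ℝ) ∂l)) := by
    refine tendsto_integral_of_dominated_convergence (fun x => |x|) ?_ hl.abs ?_ ?_
    · intro n
      exact Measurable.aestronglyMeasurable (by fun_prop)
    · intro n
      filter_upwards with x
      rw [Real.norm_eq_abs, abs_of_nonneg (by positivity)]
      exact mul_le_of_le_one_right (abs_nonneg _) (min_le_left _ _)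
    · filter_upwards with x
      have h1 : Filter.Tendsto (fun n : ℕ => x / ((n:ℝ) + 1)) Filter.atTop (nhds 0) := by
        have := (tendsto_one_div_add_atTop_nhds_zero_nat (𝕜 := ℝ)).const_mul x
        simpa [div_eq_mul_inv] using this
      have h2 := ((tendsto_const_nhds (x := (1:ℝ))).min h1.abs).const_mul |x|
      simpa using h2
  rw [integral_zero] at this
  obtain ⟨n, hn⟩ := (this.eventually (gt_mem_nhds hδ)).exists
  exact ⟨(n:ℝ) + 1, by positivity, hn.le⟩

lemma KK_nonneg (w u : ℝ) : 0 ≤ KK w u := by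
  unfold KK
  split_ifs <;> positivity

lemma KK_meas : Measurable (fun p : ℝ × ℝ => KK p.1 p.2) := by
  unfold KK
  refine Measurable.add (by fun_prop) ?_
  refine Measurable.ite ?_ measurable_const measurable_const
  refine MeasurableSet.inter (s₁ := {a : ℝ × ℝ | 1 < |a.2|}) (s₂ := {a : ℝ × ℝ | |a.1| ≤ 2 * |a.2|}) ?_ ?_
  · exact measurableSet_lt (by fun_prop) (by fun_prop)
  · exact measurableSet_le (by fun_prop) (by fun_prop)

lemma KK_lint (u : ℝ) : ∫⁻ w, ENNReal.ofReal (KK w u) ≤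
    ENNReal.ofReal ((144 * Real.pi + 4) * (|u| * min 1 |u|)) := by
  unfold KK
  have e : ∀ w : ℝ, ENNReal.ofReal (144 * (|u| * min 1 |u|) * (1 + w ^ 2)⁻¹ +
      (if 1 < |u| ∧ |w| ≤ 2 * |u| then 1 else 0)) =
      ENNReal.ofReal (144 * (|u| * min 1 |u|) * (1 + w ^ 2)⁻¹) +
      ENNReal.ofReal (if 1 < |u| ∧ |w| ≤ 2 * |u| then 1 else 0) := fun w =>
    ENNReal.ofReal_add (by positivity) (by split_ifs <;> norm_num)
  simp_rw [e]
  rw [lintegral_add_left (by fun_prop), ← ofReal_integral_eq_lintegral_ofReal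
    (integrable_inv_one_add_sq.const_mul _) (Filter.Eventually.of_forall fun w => by positivity),
    integral_const_mul, integral_univ_inv_one_add_sq, add_mul,
    ENNReal.ofReal_add (by positivity) (by positivity)]
  refine add_le_add (le_of_eq (by ring_nf)) ?_
  by_cases hu : 1 < |u|
  · calc _ = ∫⁻ w, (Set.Icc (-(2*|u|)) (2*|u|)).indicator 1 w := by
          refine lintegral_congr fun w => ?_
          by_cases hw : |w| ≤ 2 * |u|
          · rw [if_pos ⟨hu, hw⟩, Set.indicator_of_mem (by rwa [Set.mem_Icc, ← abs_le])]; simp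
          · rw [if_neg (by tauto), Set.indicator_of_notMem (by rwa [Set.mem_Icc, ← abs_le])]; simp
      _ ≤ _ := by
        rw [lintegral_indicator_one measurableSet_Icc, Real.volume_Icc, min_eq_left hu.le]
        apply ENNReal.ofReal_le_ofReal; linarith
  · simp [hu]

lemma gauss_Iic (σ : ℝ) (hσ : 0 < σ) (y : ℝ) :
    gaussianReal 0 (NNReal.mk (σ ^ 2) (sq_nonneg _)) (Set.Iic y) = ENNReal.ofReal (gPhi (y / σ)) := by
  have := gaussianReal_map_const_mul (μ := 0) (v := 1) σ
  rw [mul_zero, mul_one] at this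
  rw [← this, Measure.map_apply (by fun_prop) measurableSet_Iic, gPhi, ofReal_cdf]
  congr 1
  ext x
  simp [le_div_iff₀ hσ, mul_comm]

lemma gPhi_meas : Measurable gPhi := (monotone_cdf _).measurable

lemma gPhi_integrable (ρ : Measure ℝ) [IsProbabilityMeasure ρ] (s σ : ℝ) :
    Integrable (fun x => gPhi (s - x / σ)) ρ := by
  refine Integrable.of_bound (C := 1) (gPhi_meas.comp (by fun_prop)).aestronglyMeasurable ?_
  filter_upwards with x
  rw [Real.norm_eq_abs, abs_of_nonneg (gPhi_mem _).1]
  exact (gPhi_mem _).2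

lemma smooth_Iic (ρ : Measure ℝ) [IsProbabilityMeasure ρ] (σ : ℝ) (hσ : 0 < σ) (t : ℝ) :
    (ρ.conv (gaussianReal 0 (NNReal.mk (σ ^ 2) (sq_nonneg _)))) (Set.Iic t) =
      ENNReal.ofReal (∫ x, gPhi (t / σ - x / σ) ∂ρ) := by
  rw [Measure.conv_comm, conv_Iic, ofReal_integral_eq_lintegral_ofReal (gPhi_integrable _ _ _)
    (Filter.Eventually.of_forall fun x => (gPhi_mem _).1)]
  refine lintegral_congr fun x => ?_
  rw [gauss_Iic σ hσ, sub_div]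

lemma rem_integrable (ρ : Measure ℝ) [IsProbabilityMeasure ρ] (hρ : Integrable (fun x : ℝ => x) ρ)
    (s σ : ℝ) : Integrable (fun x => rem s (x / σ)) ρ :=
  ((gPhi_integrable ρ s σ).sub (integrable_const _)).add ((hρ.div_const σ).mul_const _)

lemma expand (ρ : Measure ℝ) [IsProbabilityMeasure ρ] (hρ : Integrable (fun x : ℝ => x) ρ)
    (s σ : ℝ) : ∫ x, gPhi (s - x / σ) ∂ρ =
      gPhi s - (∫ x, x ∂ρ) / σ * gphi s + ∫ x, rem s (x / σ) ∂ρ := by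
  have : ∫ x, rem s (x / σ) ∂ρ = ∫ x, gPhi (s - x / σ) ∂ρ - gPhi s + (∫ x, x ∂ρ) / σ * gphi s := by
    unfold rem
    have hi : Integrable (fun x => gPhi (s - x / σ) - gPhi s) ρ :=
      (gPhi_integrable ρ s σ).sub (integrable_const _)
    rw [integral_add hi
      ((hρ.div_const σ).mul_const _), integral_sub (gPhi_integrable ρ s σ) (integrable_const _),
      integral_mul_const, integral_div]
    simp
  rw [this]; ring

lemma analytic (μ ν : Measure ℝ) [IsProbabilityMeasure μ] [IsProbabilityMeasure ν]
    (hμ : Integrable (fun x : ℝ => x) μ) (hν : Integrable (fun x : ℝ => x) ν)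
    (hmean : (∫ x, x ∂ν) < ∫ x, x ∂μ)
    (ε : ℝ) (hε : ε ∈ Set.Ioo (0 : ℝ) 1) :
    ∃ σ : ℝ, ∃ _ : 0 < σ, ∃ Q : Measure ℝ, Q Set.univ ≤ ENNReal.ofReal ε ∧
      (∀ t, (μ.conv (gaussianReal 0 (NNReal.mk (σ ^ 2) (sq_nonneg _)))) (Set.Iic t) -
        (ν.conv (gaussianReal 0 (NNReal.mk (σ ^ 2) (sq_nonneg _)))) (Set.Iic t) ≤
      ∫⁻ x, ((ν.conv (gaussianReal 0 (NNReal.mk (σ ^ 2) (sq_nonneg _)))) (Set.Iic (t - x)) -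
        (μ.conv (gaussianReal 0 (NNReal.mk (σ ^ 2) (sq_nonneg _)))) (Set.Iic (t - x))) ∂Q) ∧
      (μ.conv (gaussianReal 0 (NNReal.mk (σ ^ 2) (sq_nonneg _)))) (Set.Iic 0) <
        (ν.conv (gaussianReal 0 (NNReal.mk (σ ^ 2) (sq_nonneg _)))) (Set.Iic 0) := by
  obtain ⟨he0, he1⟩ := hε
  set c := (∫ x, x ∂μ) - ∫ x, x ∂ν with hc
  have hc0 : 0 < c := sub_pos.2 hmean
  set d := c * gphi 1 / 2 with hd
  have hd0 : 0 < d := by have := gphi_pos 1; positivity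
  set C := 144 * Real.pi + 4 with hC
  have hC0 : 0 < C := by positivity
  have hl : Integrable (fun x : ℝ => x) (μ + ν) := hμ.add_measure hν
  obtain ⟨σ, hσ, hI⟩ := exists_sigma (μ + ν) hl (d * ε / C) (by positivity)
  set kk : ℝ → ℝ≥0∞ := fun w => ∫⁻ x, ENNReal.ofReal (KK w (x / σ)) ∂(μ + ν) with hkk
  have mKK : Measurable (fun p : ℝ × ℝ => ENNReal.ofReal (KK p.1 (p.2 / σ))) :=
    (KK_meas.comp (f := fun p : ℝ × ℝ => (p.1, p.2 / σ)) (by fun_prop)).ennreal_ofReal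
  have mkk : Measurable kk := mKK.lintegral_prod_right'
  have hkkint : ∫⁻ w, kk w ≤ ENNReal.ofReal (d * ε / σ) := by
    rw [hkk, lintegral_lintegral_swap mKK.aemeasurable]
    refine (lintegral_mono fun x => KK_lint (x / σ)).trans ?_
    have hint : Integrable (fun x => (144 * Real.pi + 4) * (|x / σ| * min 1 |x / σ|)) (μ + ν) := by
      refine Integrable.const_mul ?_ _
      refine (hl.div_const σ).abs.mono' (Measurable.aestronglyMeasurable (by fun_prop)) ?_
      filter_upwards with x
      rw [Real.norm_eq_abs, abs_of_nonneg (by positivity)]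
      exact mul_le_of_le_one_right (abs_nonneg _) (min_le_left _ _)
    rw [← ofReal_integral_eq_lintegral_ofReal hint
      (Filter.Eventually.of_forall fun w => by positivity)]
    apply ENNReal.ofReal_le_ofReal
    have e : (fun x => (144 * Real.pi + 4) * (|x / σ| * min 1 |x / σ|)) =
        fun x => (C / σ) * (|x| * min 1 |x / σ|) := by
      ext x
      have : |x / σ| = |x| / σ := by rw [abs_div, abs_of_pos hσ]
      rw [← hC, this]; ring
    rw [e, integral_const_mul]
    calc _ ≤ C / σ * (d * ε / C) := by gcongr
      _ = _ := by field_simp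
  set R : ℝ → ℝ := fun s => ∫ x, rem s (x / σ) ∂ν - ∫ x, rem s (x / σ) ∂μ with hR
  have hRk : ∀ s w, w ≤ s → s ≤ w + 1 → ENNReal.ofReal |R s| ≤ kk w := by
    intro s w h1 h2
    have hb : ∀ ρ : Measure ℝ, ENNReal.ofReal |∫ x, rem s (x / σ) ∂ρ| ≤
        ∫⁻ x, ENNReal.ofReal (KK w (x / σ)) ∂ρ := by
      intro ρ
      rw [← Real.enorm_eq_ofReal_abs]
      refine (enorm_integral_le_lintegral_enorm _).trans (lintegral_mono fun x => ?_)
      rw [Real.enorm_eq_ofReal_abs]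
      exact ENNReal.ofReal_le_ofReal (rem_bound s w _ h1 h2)
    calc ENNReal.ofReal |R s| ≤ ENNReal.ofReal (|∫ x, rem s (x / σ) ∂ν| + |∫ x, rem s (x / σ) ∂μ|) :=
          ENNReal.ofReal_le_ofReal (abs_sub _ _)
      _ = ENNReal.ofReal |∫ x, rem s (x / σ) ∂ν| + ENNReal.ofReal |∫ x, rem s (x / σ) ∂μ| :=
          ENNReal.ofReal_add (abs_nonneg _) (abs_nonneg _)
      _ ≤ kk w := by
          rw [hkk]; simp only
          rw [lintegral_add_measure, add_comm]
          exact add_le_add (hb μ) (hb ν)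
  have hRint : ∀ s, ENNReal.ofReal |R s| ≤ ∫⁻ w in Set.Icc (s - 1) s, kk w := by
    intro s
    calc ENNReal.ofReal |R s| = ∫⁻ w in Set.Icc (s - 1) s, ENNReal.ofReal |R s| := by
          rw [setLIntegral_const, Real.volume_Icc]; simp
      _ ≤ _ := setLIntegral_mono mkk fun w hw => hRk s w hw.2 (by linarith [hw.1])
  have hRsmall : ∀ s, |R s| ≤ d * ε / σ := fun s => by
    have := (hRint s).trans ((setLIntegral_le_lintegral _ _).trans hkkint)
    rwa [ENNReal.ofReal_le_ofReal_iff (by positivity)] at this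
  set A : ℝ → ℝ := fun s => ∫ x, gPhi (s - x / σ) ∂μ with hA
  set B : ℝ → ℝ := fun s => ∫ x, gPhi (s - x / σ) ∂ν with hB
  have hBA : ∀ s, B s - A s = c / σ * gphi s + R s := by
    intro s
    simp only [hA, hB, hR]
    rw [expand μ hμ, expand ν hν, hc]; ring
  have hA0 : ∀ s, 0 ≤ A s := fun s => integral_nonneg fun x => (gPhi_mem _).1
  have hB0 : ∀ s, 0 ≤ B s := fun s => integral_nonneg fun x => (gPhi_mem _).1
  have hlow : ∀ s, 0 ≤ s → s ≤ 1 → d / σ ≤ B s - A s := by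
    intro s h0 h1
    rw [hBA]
    have hg : gphi 1 ≤ gphi s := by
      rw [gphi_eq, gphi_eq]
      gcongr
    have h2 : c / σ * gphi 1 ≤ c / σ * gphi s := by gcongr
    have h3 := neg_abs_le (R s)
    have h4 := hRsmall s
    have h5 : d * ε / σ ≤ d / σ := by
      gcongr; nlinarith
    have h6 : c / σ * gphi 1 = 2 * (d / σ) := by rw [hd]; ring
    linarith
  refine ⟨σ, hσ, Measure.map (fun w => σ * w)
    (volume.withDensity (fun w => ENNReal.ofReal (σ / d) * kk w)), ?_, ?_, ?_⟩
  · rw [Measure.map_apply (by fun_prop) MeasurableSet.univ, Set.preimage_univ,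
      withDensity_apply _ MeasurableSet.univ, Measure.restrict_univ, lintegral_const_mul _ mkk]
    calc _ ≤ ENNReal.ofReal (σ / d) * ENNReal.ofReal (d * ε / σ) := by gcongr
      _ = ENNReal.ofReal ε := by
        rw [← ENNReal.ofReal_mul (by positivity)]
        congr 1; field_simp
  · intro t
    simp_rw [smooth_Iic μ σ hσ, smooth_Iic ν σ hσ]
    change ENNReal.ofReal (A (t / σ)) - ENNReal.ofReal (B (t / σ)) ≤
      ∫⁻ x, ENNReal.ofReal (B ((t - x) / σ)) - ENNReal.ofReal (A ((t - x) / σ)) ∂_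
    simp_rw [← ENNReal.ofReal_sub _ (hA0 _), ← ENNReal.ofReal_sub _ (hB0 _)]
    have mAux : ∀ ρ : Measure ℝ, IsProbabilityMeasure ρ →
        Measurable (fun s => ∫ x, gPhi (s - x / σ) ∂ρ) := by
      intro ρ _
      have : Monotone (fun s => ∫ x, gPhi (s - x / σ) ∂ρ) := fun a b hab =>
        integral_mono (gPhi_integrable _ _ _) (gPhi_integrable _ _ _)
          fun x => monotone_cdf _ (by linarith)
      exact this.measurable
    have mA : Measurable A := mAux μ inferInstance
    have mB : Measurable B := mAux ν inferInstance
    have mBA : Measurable (fun x => ENNReal.ofReal (B ((t - x) / σ) - A ((t - x) / σ))) :=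
      ((mB.comp (by fun_prop)).sub (mA.comp (by fun_prop))).ennreal_ofReal
    have mBA' : Measurable (fun w => ENNReal.ofReal (B ((t - σ * w) / σ) - A ((t - σ * w) / σ))) :=
      mBA.comp (by fun_prop : Measurable fun w : ℝ => σ * w)
    rw [lintegral_map mBA (by fun_prop), lintegral_withDensity_eq_lintegral_mul _
      (mkk.const_mul _) mBA']
    set s := t / σ with hs
    calc ENNReal.ofReal (A s - B s) ≤ ENNReal.ofReal |R s| := by
          apply ENNReal.ofReal_le_ofReal
          have := hBA s
          have h3 := neg_abs_le (R s)
          have : 0 ≤ c / σ * gphi s := by have := gphi_pos s; positivity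
          linarith
      _ ≤ ∫⁻ w in Set.Icc (s - 1) s, kk w := hRint s
      _ ≤ ∫⁻ w in Set.Icc (s - 1) s, ((fun w => ENNReal.ofReal (σ / d) * kk w) *
            fun w => ENNReal.ofReal (B ((t - σ * w) / σ) - A ((t - σ * w) / σ))) w := by
          refine setLIntegral_mono ((mkk.const_mul _).mul mBA') fun w hw => ?_
          have e : (t - σ * w) / σ = s - w := by rw [hs]; field_simp
          simp only [Pi.mul_apply]
          rw [e]
          have := hlow (s - w) (by linarith [hw.2]) (by linarith [hw.1])
          calc kk w = ENNReal.ofReal (σ / d) * kk w * ENNReal.ofReal (d / σ) := by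
                rw [mul_right_comm, ← ENNReal.ofReal_mul (by positivity)]
                have : σ / d * (d / σ) = 1 := by field_simp
                rw [this]; simp
            _ ≤ _ := by gcongr
      _ ≤ _ := setLIntegral_le_lintegral _ _
  · rw [smooth_Iic μ σ hσ, smooth_Iic ν σ hσ]
    change ENNReal.ofReal (A (0 / σ)) < ENNReal.ofReal (B (0 / σ))
    rw [zero_div]
    have h1 := hlow 0 le_rfl zero_le_one
    have h2 : 0 < d / σ := by positivity
    rw [ENNReal.ofReal_lt_ofReal_iff_of_nonneg (hA0 0)]
    linarith

theorem stmt_6 (μ ν : Measure ℝ) [IsProbabilityMeasure μ] [IsProbabilityMeasure ν]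
    (hμ : Integrable (fun x : ℝ => x) μ) (hν : Integrable (fun x : ℝ => x) ν)
    (hmean : (∫ x, x ∂ν) < ∫ x, x ∂μ)
    (ε : ℝ) (hε : ε ∈ Set.Ioo (0 : ℝ) 1) :
    ∃ v : ℝ≥0, 0 < v ∧ ∃ H : Measure ℝ, IsProbabilityMeasure H ∧
      StrictFSD
        (μ.conv (ENNReal.ofReal (1 - ε) • gaussianReal 0 v + ENNReal.ofReal ε • H))
        (ν.conv (ENNReal.ofReal (1 - ε) • gaussianReal 0 v + ENNReal.ofReal ε • H)) := by
  obtain ⟨σ, hσ, Q, hQ, h, h0⟩ := analytic μ ν hμ hν hmean ε hε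
  refine ⟨(NNReal.mk (σ ^ 2) (sq_nonneg _)), ?_, ?_⟩
  · rw [← NNReal.coe_pos]
    exact pow_pos hσ 2
  · exact assemble μ ν _ Q ε hε hQ h h0
end
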